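/- Let D ∈ CD_{n,k} be a chord diagram, C a domino matrix of D satisfying the sign rules, Z ∈ Mat_{n×(k+4)}(ℝ) positive, and Y = CZ. If c = (i, i+1, j, j+1) is a top chord of D, then ⟨Y a₁ a₂ a₃ a₄⟩ ≠ 0 for every 4-element subset {a₁ < a₂ < a₃ < a₄} of {i, i+1, j, j+1, n}. If c = (i, i+1, j, j+1) is a chord of D that is not a top chord, then ⟨Y i i+1 j j+1⟩ ≠ 0. -/

import Mathlib

open scoped Classical

noncomputable section

/-- A rectangular `n × r` matrix (with `r ≤ n`) is *positive* if all of its maximal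
`r × r` minors (rows selected in increasing order) have positive determinant. -/
def IsPositiveMatrix {n r : ℕ} (Z : Matrix (Fin n) (Fin r) ℝ) : Prop :=
  ∀ f : Fin r → Fin n, StrictMono f → 0 < (Z.submatrix f id).det

/-- A `k × n` matrix is *totally nonnegative* if all of its `k × k` minors
(columns selected in increasing order) have nonnegative determinant. -/
def IsTotallyNonnegRect {k n : ℕ} (C : Matrix (Fin k) (Fin n) ℝ) : Prop :=
  ∀ g : Fin k → Fin n, StrictMono g → 0 ≤ (C.submatrix id g).det

/-- The row of `Z` whose (1-based) marker is `p`, i.e. the row with index `p - 1`. -/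
def markerRow {n r : ℕ} (Z : Matrix (Fin n) (Fin r) ℝ) (p : ℕ) : Fin r → ℝ :=
  if h : p - 1 < n then Z ⟨p - 1, h⟩ else 0

/-- The twistor coordinate `⟨Y a₁ a₂ a₃ a₄⟩`: the determinant of the `(k+4) × (k+4)` matrix
whose rows are the `k` rows of `Y` followed by the rows of `Z` with (1-based) markers
`a 0, a 1, a 2, a 3`. -/
def twistor {n k : ℕ} (Z : Matrix (Fin n) (Fin (k + 4)) ℝ)
    (Y : Matrix (Fin k) (Fin (k + 4)) ℝ) (a : Fin 4 → ℕ) : ℝ :=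
  ((Matrix.fromRows Y (Matrix.of fun t => markerRow Z (a t))).submatrix
    (⇑finSumFinEquiv.symm) id).det

/-- The row space of a matrix: the span of its rows. -/
def rowSpace {k n : ℕ} (A : Matrix (Fin k) (Fin n) ℝ) : Submodule ℝ (Fin n → ℝ) :=
  Submodule.span ℝ (Set.range fun r => A r)

/-- The minor of `A` on the set of rows `S` (taken in increasing order), using all columns;
defined to be `0` if `S` does not have the right cardinality. -/
def rowMinor {N r : ℕ} (A : Matrix (Fin N) (Fin r) ℝ) (S : Finset (Fin N)) : ℝ :=
  if h : S.card = r then (A.submatrix (fun t => (S.orderIsoOfFin h t).1) id).det else 0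

/-- The minor of `C` on the set of columns `J` (taken in increasing order), using all rows;
defined to be `0` if `J` does not have the right cardinality. -/
def colMinor {k N : ℕ} (C : Matrix (Fin k) (Fin N) ℝ) (J : Finset (Fin N)) : ℝ :=
  if h : J.card = k then (C.submatrix id (fun t => (J.orderIsoOfFin h t).1)).det else 0


/-- A chord diagram with `n` markers (labelled `1, …, n`) and `k` chords
`c_l = (tail l, tail l + 1, head l, head l + 1)`. -/
structure ChordDiagram (n k : ℕ) where
  tail : Fin k → ℕ
  head : Fin k → ℕ
  one_le_tail : ∀ l, 1 ≤ tail l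
  tail_add_two_le_head : ∀ l, tail l + 2 ≤ head l
  head_add_two_le : ∀ l, head l + 2 ≤ n
  tail_strictMono : StrictMono tail
  noncrossing : ∀ l m : Fin k, l < m → ¬(tail m < head l ∧ head l < head m)

namespace ChordDiagram

variable {n k : ℕ} (D : ChordDiagram n k)

/-- `c_m` is a descendant of `c_l`. -/
def Descendant (l m : Fin k) : Prop := D.tail l < D.tail m ∧ D.head m ≤ D.head l

/-- The number of descendants of `c_l`. -/
def below (l : Fin k) : ℕ := (Finset.univ.filter fun m => D.Descendant l m).card

/-- `c_l` is a top chord: it has no ancestor. -/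
def IsTop (l : Fin k) : Prop := ∀ m, ¬ D.Descendant m l

/-- `c_m` is the parent of `c_l`: the ancestor of `c_l` with the largest start. -/
def IsParent (m l : Fin k) : Prop :=
  D.Descendant m l ∧ ∀ m', D.Descendant m' l → D.tail m' ≤ D.tail m

/-- The number of chords starting after the start of `c_l` (equals `k - l` for the
`l`-th chord in the 1-based start-increasing ordering). -/
def behind (l : Fin k) : ℕ := (Finset.univ.filter fun m => D.tail l < D.tail m).card

/-- The number of descendants of `c_m` (the parent of `c_l`) that come before `c_l`
(equals `l - m - 1` in the 1-based start-increasing ordering). -/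
def beyond (l m : Fin k) : ℕ :=
  (Finset.univ.filter fun h => D.Descendant m h ∧ D.tail h < D.tail l).card

/-- The domino matrix of `D` with variables `α, β, γ, δ, ε` : the column with (0-based)
index `a` corresponds to the (1-based) marker `a + 1`. -/
def dominoMatrix (α β γ δ ε : Fin k → ℝ) : Matrix (Fin k) (Fin n) ℝ :=
  Matrix.of fun l a =>
    (if (a : ℕ) + 1 = D.tail l then α l else 0) +
    (if (a : ℕ) + 1 = D.tail l + 1 then β l else 0) +
    (if (a : ℕ) + 1 = D.head l then γ l else 0) +
    (if (a : ℕ) + 1 = D.head l + 1 then δ l else 0) +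
    (if D.IsTop l ∧ (a : ℕ) + 1 = n then ε l else 0) +
    (∑ m : Fin k, if D.IsParent m l then
        (if (a : ℕ) + 1 = D.tail m then ε l * α m else 0) +
        (if (a : ℕ) + 1 = D.tail m + 1 then ε l * β m else 0)
      else 0)

/-- The sign rules for the domino variables of `D`. -/
def SignRules (α β γ δ ε : Fin k → ℝ) : Prop :=
  (∀ l, 0 < α l) ∧ (∀ l, 0 < β l) ∧
  (∀ l, 0 < (-1 : ℝ) ^ D.below l * γ l) ∧
  (∀ l, 0 < (-1 : ℝ) ^ D.below l * δ l) ∧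
  (∀ l, D.IsTop l → 0 < (-1 : ℝ) ^ D.behind l * ε l) ∧
  (∀ l m, D.IsParent m l → 0 < (-1 : ℝ) ^ D.beyond l m * ε l) ∧
  (∀ l m, D.IsParent m l → D.head l = D.head m → δ l / γ l < δ m / γ m) ∧
  (∀ l m, D.head m = D.tail l → δ m / γ m < β l / α l)

end ChordDiagram

open scoped NNReal

section Cones

variable {V : Type*} [AddCommGroup V] [Module ℝ V] {σ : Type*}

/-- The exterior product of a list of vectors. -/
def wedge (l : List V) : ExteriorAlgebra ℝ V := (l.map (ExteriorAlgebra.ι ℝ)).prod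

@[simp] lemma wedge_nil : wedge ([] : List V) = 1 := rfl

@[simp] lemma wedge_cons (v : V) (l : List V) :
    wedge (v :: l) = ExteriorAlgebra.ι ℝ v * wedge l := by simp [wedge]

@[simp] lemma wedge_append (l l' : List V) : wedge (l ++ l') = wedge l * wedge l' := by
  simp [wedge]

lemma wedge_mul_ι (l : List V) (v : V) :
    wedge l * ExteriorAlgebra.ι ℝ v = (-1 : ℝ) ^ l.length • (ExteriorAlgebra.ι ℝ v * wedge l) := by
  induction l with
  | nil => simp
  | cons a l ih =>
    have h := eq_neg_of_add_eq_zero_left (ExteriorAlgebra.ι_add_mul_swap (R := ℝ) a v)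
    rw [wedge_cons, mul_assoc, ih, mul_smul_comm, ← mul_assoc, h, List.length_cons, pow_succ]
    simp [mul_assoc]

/-- The convex cone spanned by the exterior products of sublists of `l.map f` of length `d - j`. -/
def wedgeCone (f : σ → V) (l : List σ) (j d : ℕ) : Submodule ℝ≥0 (ExteriorAlgebra ℝ V) :=
  Submodule.span ℝ≥0 {x | ∃ l' : List σ, l'.Sublist l ∧ l'.length + j = d ∧ x = wedge (l'.map f)}

variable {f : σ → V} {l l' : List σ} {j j' d d' : ℕ} {x y : ExteriorAlgebra ℝ V}

lemma wedge_mem_wedgeCone {s : List σ} (h : s.Sublist l) (hd : s.length + j = d) :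
    wedge (s.map f) ∈ wedgeCone f l j d := Submodule.subset_span ⟨s, h, hd, rfl⟩

lemma smul_mem_wedgeCone {c : ℝ} (hc : 0 ≤ c) (hx : x ∈ wedgeCone f l j d) :
    c • x ∈ wedgeCone f l j d :=
  (wedgeCone f l j d).smul_mem ⟨c, hc⟩ hx

lemma wedgeCone_induction {p : ExteriorAlgebra ℝ V → Prop}
    (wedge_mem : ∀ s : List σ, s.Sublist l → s.length + j = d → p (wedge (s.map f)))
    (zero : p 0) (add : ∀ x y, p x → p y → p (x + y))
    (smul : ∀ (c : ℝ) x, 0 ≤ c → p x → p (c • x)) (hx : x ∈ wedgeCone f l j d) : p x := by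
  induction hx using Submodule.span_induction with
  | mem x hx => obtain ⟨s, h1, h2, rfl⟩ := hx; exact wedge_mem s h1 h2
  | zero => exact zero
  | add x y _ _ hx hy => exact add x y hx hy
  | smul a x _ hx => rw [NNReal.smul_def]; exact smul a x a.2 hx

lemma mul_mem_wedgeCone (hx : x ∈ wedgeCone f l j d) (hy : y ∈ wedgeCone f l' j' d') :
    x * y ∈ wedgeCone f (l ++ l') (j + j') (d + d') := by
  refine wedgeCone_induction (p := fun z => z * y ∈ wedgeCone f (l ++ l') (j + j') (d + d'))
    (fun s hs hd => ?_) ?_ (fun a b ha hb => ?_) (fun c a hc ha => ?_) hx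
  · refine wedgeCone_induction (p := fun z => wedge (s.map f) * z ∈
      wedgeCone f (l ++ l') (j + j') (d + d')) (fun s' hs' hd' => ?_) ?_ (fun a b ha hb => ?_)
      (fun c a hc ha => ?_) hy
    · rw [← wedge_append, ← List.map_append]
      exact wedge_mem_wedgeCone (hs.append hs') (by rw [List.length_append]; omega)
    · rw [mul_zero]; exact zero_mem _
    · rw [mul_add]; exact add_mem ha hb
    · rw [mul_smul_comm]; exact smul_mem_wedgeCone hc ha
  · rw [zero_mul]; exact zero_mem _
  · rw [add_mul]; exact add_mem ha hb
  · rw [smul_mul_assoc]; exact smul_mem_wedgeCone hc ha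

lemma wedgeCone_mono (h : l.Sublist l') (hd : j + d' = j' + d) (hx : x ∈ wedgeCone f l j d) :
    x ∈ wedgeCone f l' j' d' :=
  wedgeCone_induction (fun _ hs hl => wedge_mem_wedgeCone (hs.trans h) (by omega)) (zero_mem _)
    (fun _ _ => add_mem) (fun _ _ hc ha => smul_mem_wedgeCone hc ha) hx

lemma mul_mem_wedgeCone_of_sublist {w : List σ} {i e : ℕ} (hx : x ∈ wedgeCone f l j d)
    (hy : y ∈ wedgeCone f l' j' d') (hw : (l ++ l').Sublist w)
    (h : j + j' + e = i + (d + d')) : x * y ∈ wedgeCone f w i e := by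
  have h1 := mul_mem_wedgeCone hx hy
  exact wedgeCone_mono hw h h1

lemma wedgeCone_mul_ι (hx : x ∈ wedgeCone f l 0 d) (v : V) :
    x * ExteriorAlgebra.ι ℝ v = (-1 : ℝ) ^ d • (ExteriorAlgebra.ι ℝ v * x) := by
  refine wedgeCone_induction (p := fun z => z * ExteriorAlgebra.ι ℝ v =
    (-1 : ℝ) ^ d • (ExteriorAlgebra.ι ℝ v * z)) (fun s _ hl => ?_) ?_ (fun a b ha hb => ?_)
    (fun c a _ ha => ?_) hx
  · rw [wedge_mul_ι, List.length_map]; congr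
  · simp
  · rw [add_mul, mul_add, smul_add, ha, hb]
  · rw [smul_mul_assoc, ha, mul_smul_comm, smul_comm]

/-- `x` lies in the cone of `l`, with a positive coefficient at the exterior product of the
sublist `s`. -/
def WedgePos (f : σ → V) (l s : List σ) (x : ExteriorAlgebra ℝ V) : Prop :=
  s.Sublist l ∧ ∃ c : ℝ, 0 < c ∧ ∃ y ∈ wedgeCone f l 0 s.length, x = c • wedge (s.map f) + y

variable {s s' : List σ}

lemma WedgePos.mem (h : WedgePos f l s x) (hd : s.length + j = d) : x ∈ wedgeCone f l j d := by
  obtain ⟨hs, c, hc, y, hy, rfl⟩ := h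
  exact add_mem (smul_mem_wedgeCone hc.le (wedge_mem_wedgeCone hs hd))
    (wedgeCone_mono (List.Sublist.refl _) (by omega) hy)

lemma WedgePos.add (h : WedgePos f l s x) (hy : y ∈ wedgeCone f l 0 s.length) :
    WedgePos f l s (x + y) := by
  obtain ⟨hs, c, hc, z, hz, rfl⟩ := h
  exact ⟨hs, c, hc, z + y, add_mem hz hy, add_assoc _ _ _⟩

lemma WedgePos.smul {c : ℝ} (h : WedgePos f l s x) (hc : 0 < c) : WedgePos f l s (c • x) := by
  obtain ⟨hs, a, ha, z, hz, rfl⟩ := h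
  exact ⟨hs, c * a, mul_pos hc ha, c • z, smul_mem_wedgeCone hc.le hz, by
    rw [smul_add, smul_smul]⟩

lemma WedgePos.mono (h : WedgePos f l s x) (hl : l.Sublist l') : WedgePos f l' s x := by
  obtain ⟨hs, a, ha, z, hz, rfl⟩ := h
  exact ⟨hs.trans hl, a, ha, z, wedgeCone_mono hl rfl hz, rfl⟩

lemma WedgePos.mul (h : WedgePos f l s x) (h' : WedgePos f l' s' y) :
    WedgePos f (l ++ l') (s ++ s') (x * y) := by
  obtain ⟨hs, a, ha, z, hz, rfl⟩ := h
  have hy := h'.mem (j := 0) (add_zero _)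
  obtain ⟨hs', b, hb, w, hw, rfl⟩ := h'
  refine ⟨hs.append hs', a * b, mul_pos ha hb,
    a • (wedge (s.map f) * w) + z * (b • wedge (s'.map f) + w), ?_, ?_⟩
  · rw [List.length_append]
    have hs0 : wedge (s.map f) ∈ wedgeCone f l 0 s.length := wedge_mem_wedgeCone hs (add_zero _)
    have h1 := mul_mem_wedgeCone hs0 hw
    have h2 := mul_mem_wedgeCone hz hy
    exact add_mem (smul_mem_wedgeCone ha.le h1) h2
  · rw [List.map_append, wedge_append, add_mul, mul_add, smul_mul_smul_comm, smul_mul_assoc,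
      add_assoc]

lemma wedgePos_nil : WedgePos f l [] (1 : ExteriorAlgebra ℝ V) :=
  ⟨List.nil_sublist _, 1, one_pos, 0, zero_mem _, by simp⟩

lemma wedgePos_self : WedgePos f l l (wedge (l.map f)) :=
  ⟨List.Sublist.refl _, 1, one_pos, 0, zero_mem _, by simp⟩

end Cones

section Forests

/-- Ordered forests: `node a G R` has first root `a`, whose children form the forest `G`, and the
remaining trees form the forest `R`. -/
inductive Forest (σ : Type*)
  | nil : Forest σ
  | node (a : σ) (G R : Forest σ) : Forest σ

namespace Forest

variable {σ τ : Type*} {V : Type*} [AddCommGroup V] [Module ℝ V]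

/-- The number of nodes. -/
def size : Forest σ → ℕ
  | nil => 0
  | node _ G R => G.size + R.size + 1

/-- The nodes in preorder. -/
def nodes : Forest σ → List σ
  | nil => []
  | node a G R => a :: (G.nodes ++ R.nodes)

/-- The word visiting `tl a` when a node `a` is entered and `hd a` when it is left. -/
def word (tl hd : σ → List τ) : Forest σ → List τ
  | nil => []
  | node a G R => tl a ++ (G.word tl hd ++ (hd a ++ R.word tl hd))

/-- The exterior product of the rows attached to the nodes; `u` is the vector contributed by the
parent, and `b` the number of nodes below that parent which have already been visited. -/
def expand (T H : σ → V) (ε : σ → ℝ) : ℕ → Forest σ → V → ExteriorAlgebra ℝ V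
  | _, nil, _ => 1
  | b, node a G R, u =>
    ExteriorAlgebra.ι ℝ (T a + (-1 : ℝ) ^ G.size • H a + ((-1 : ℝ) ^ b * ε a) • u) *
      (expand T H ε 0 G (T a) * expand T H ε (b + G.size + 1) R u)

lemma length_nodes (t : Forest σ) : t.nodes.length = t.size := by
  induction t with
  | nil => rfl
  | node a G R hG hR => simp [nodes, size, hG, hR]

lemma neg_one_pow_cancel (b g : ℕ) : (-1 : ℝ) ^ (b + g) * (-1 : ℝ) ^ g = (-1 : ℝ) ^ b := by
  rw [pow_add, mul_assoc, ← mul_pow]; simp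

lemma node_identity {A : Type*} [Ring A] [Algebra ℝ A] {t h u p w r r' : A} {e s : ℝ} {b g : ℕ}
    (hu : u * u = 0) (hh : p * h = (-1 : ℝ) ^ g • (h * p)) (hw : w = t * p + p * h)
    (hwu : w * u = (-1 : ℝ) ^ (g + 1) • (u * w)) (hpu : p * u = s • (u * p)) :
    (t + (-1 : ℝ) ^ g • h + ((-1 : ℝ) ^ b * e) • u) *
      (p * (r + (-1 : ℝ) ^ (b + g + 1) • (u * r'))) =
    w * r + (-1 : ℝ) ^ b • (u * (e • (p * r) + w * r')) := by
  have h1 : (t + (-1 : ℝ) ^ g • h + ((-1 : ℝ) ^ b * e) • u) * p =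
      w + ((-1 : ℝ) ^ b * e) • (u * p) := by
    rw [add_mul, add_mul, hw, hh, smul_mul_assoc, smul_mul_assoc]
  have h2 : u * p * (u * r') = 0 := by
    rw [mul_assoc, ← mul_assoc p, hpu, smul_mul_assoc, mul_smul_comm, ← mul_assoc, ← mul_assoc,
      hu, zero_mul, zero_mul, smul_zero]
  have h3 : (-1 : ℝ) ^ (b + g + 1) • (w * (u * r')) = (-1 : ℝ) ^ b • (u * (w * r')) := by
    rw [← mul_assoc, hwu, smul_mul_assoc, smul_smul, mul_assoc, add_assoc, neg_one_pow_cancel]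
  rw [← mul_assoc, h1, mul_add, add_mul, add_mul, mul_smul_comm, mul_smul_comm, h3,
    smul_mul_assoc, smul_mul_assoc, h2, smul_zero, smul_zero, add_zero, mul_add, smul_add,
    mul_smul_comm, smul_smul,
    ← mul_assoc u p r, add_assoc]

variable {f : τ → V} {tl hd tl' hd' : σ → List τ} {T H : σ → V} {ε : σ → ℝ}

/-- At the node `a`, exactly one of the two vectors `T a`, `H a` is selected. -/
structure Selects (f : τ → V) (tl hd tl' hd' : σ → List τ) (T H : σ → V) (ε : σ → ℝ) (a : σ) :
    Prop where
  tail_mem : ExteriorAlgebra.ι ℝ (T a) ∈ wedgeCone f (tl a) 0 1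
  head_mem : ExteriorAlgebra.ι ℝ (H a) ∈ wedgeCone f (hd a) 0 1
  pos : 0 < ε a
  select : (WedgePos f (tl a) (tl' a) (ExteriorAlgebra.ι ℝ (T a)) ∧ (tl' a).length = 1 ∧
      hd' a = []) ∨
    (tl' a = [] ∧ WedgePos f (hd a) (hd' a) (ExteriorAlgebra.ι ℝ (H a)) ∧ (hd' a).length = 1)

lemma Selects.expand_node {a : σ} (ha : Selects f tl hd tl' hd' T H ε a) {w : List τ} {d g : ℕ}
    {x y : ExteriorAlgebra ℝ V} (hx : x ∈ wedgeCone f w 0 d) (hy : y ∈ wedgeCone f w 1 d)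
    (hdg : (-1 : ℝ) ^ d = (-1 : ℝ) ^ g) :
    x + ExteriorAlgebra.ι ℝ (T a) * y ∈ wedgeCone f (tl a ++ w) 0 d ∧
    ExteriorAlgebra.ι ℝ (T a) * x + (x + ExteriorAlgebra.ι ℝ (T a) * y) *
      ExteriorAlgebra.ι ℝ (H a) ∈ wedgeCone f (tl a ++ (w ++ hd a)) 0 (d + 1) ∧
    ∀ (b : ℕ) (u : V) (r r' : ExteriorAlgebra ℝ V),
      ExteriorAlgebra.ι ℝ (T a + (-1 : ℝ) ^ g • H a + ((-1 : ℝ) ^ b * ε a) • u) *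
        ((x + ExteriorAlgebra.ι ℝ (T a) * y) *
          (r + (-1 : ℝ) ^ (b + g + 1) • (ExteriorAlgebra.ι ℝ u * r'))) =
      (ExteriorAlgebra.ι ℝ (T a) * x + (x + ExteriorAlgebra.ι ℝ (T a) * y) *
        ExteriorAlgebra.ι ℝ (H a)) * r +
      (-1 : ℝ) ^ b • (ExteriorAlgebra.ι ℝ u *
        (ε a • ((x + ExteriorAlgebra.ι ℝ (T a) * y) * r) +
          (ExteriorAlgebra.ι ℝ (T a) * x + (x + ExteriorAlgebra.ι ℝ (T a) * y) *
            ExteriorAlgebra.ι ℝ (H a)) * r')) := by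
  have h1 : x + ExteriorAlgebra.ι ℝ (T a) * y ∈ wedgeCone f (tl a ++ w) 0 d :=
    add_mem (wedgeCone_mono (List.sublist_append_right _ _) rfl hx)
      (mul_mem_wedgeCone_of_sublist ha.tail_mem hy (List.Sublist.refl _) (by omega))
  have h2 : ExteriorAlgebra.ι ℝ (T a) * x + (x + ExteriorAlgebra.ι ℝ (T a) * y) *
      ExteriorAlgebra.ι ℝ (H a) ∈ wedgeCone f (tl a ++ (w ++ hd a)) 0 (d + 1) := by
    rw [← List.append_assoc]
    exact add_mem (mul_mem_wedgeCone_of_sublist ha.tail_mem hx (List.sublist_append_left _ _)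
      (by omega)) (mul_mem_wedgeCone_of_sublist h1 ha.head_mem (List.Sublist.refl _) (by omega))
  refine ⟨h1, h2, fun b u r r' => ?_⟩
  simp only [map_add, map_smul]
  have h3 := wedgeCone_mul_ι h1 (H a)
  have h4 := wedgeCone_mul_ι h2 u
  rw [pow_succ, hdg, ← pow_succ] at h4
  rw [hdg] at h3
  refine node_identity (ExteriorAlgebra.ι_sq_zero u) h3 ?_ h4 (wedgeCone_mul_ι h1 u)
  rw [mul_add, ← mul_assoc, ExteriorAlgebra.ι_sq_zero, zero_mul, add_zero]

lemma Selects.wedgePos {a : σ} (ha : Selects f tl hd tl' hd' T H ε a) {w s : List τ} {d : ℕ}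
    {x y : ExteriorAlgebra ℝ V} (hx : WedgePos f w s x) (hs : s.length = d)
    (hy : y ∈ wedgeCone f w 1 d) :
    WedgePos f (tl a ++ (w ++ hd a)) (tl' a ++ (s ++ hd' a))
      (ExteriorAlgebra.ι ℝ (T a) * x + (x + ExteriorAlgebra.ι ℝ (T a) * y) *
        ExteriorAlgebra.ι ℝ (H a)) ∧ (tl' a ++ (s ++ hd' a)).length = d + 1 := by
  have hx0 := hx.mem (j := 0) (d := d) (by omega)
  have h1 := (ha.expand_node hx0 hy rfl).1
  have hlen : (tl' a ++ (s ++ hd' a)).length = d + 1 := by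
    rcases ha.select with ⟨-, h4, h5⟩ | ⟨h4, -, h5⟩ <;> (simp [h4, h5, hs]; try omega)
  refine ⟨?_, hlen⟩
  rcases ha.select with ⟨h4, h4', h5⟩ | ⟨h4, h5, h5'⟩
  · refine WedgePos.add ?_ ?_
    · rw [h5, List.append_nil, ← List.append_assoc]
      exact (h4.mul hx).mono (List.sublist_append_left _ _)
    · rw [hlen, ← List.append_assoc]
      exact mul_mem_wedgeCone_of_sublist h1 ha.head_mem (List.Sublist.refl _) (by omega)
  · rw [add_mul, add_comm (x * _), ← add_assoc, add_comm _ (x * _)]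
    refine WedgePos.add ?_ ?_
    · rw [h4, List.nil_append]
      exact (hx.mul h5).mono (List.sublist_append_right _ _)
    · rw [hlen, ← List.append_assoc]
      refine add_mem (mul_mem_wedgeCone_of_sublist ha.tail_mem hx0
        (List.sublist_append_left _ _) (by omega)) ?_
      exact mul_mem_wedgeCone_of_sublist (mul_mem_wedgeCone ha.tail_mem hy) ha.head_mem
        (List.Sublist.refl _) (by omega)

lemma exists_expand_eq {t : Forest σ} (ht : ∀ a ∈ t.nodes, Selects f tl hd tl' hd' T H ε a) :
    ∃ x y, WedgePos f (t.word tl hd) (t.word tl' hd') x ∧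
      (t.word tl' hd').length = t.size ∧ y ∈ wedgeCone f (t.word tl hd) 1 t.size ∧
      ∀ b u, t.expand T H ε b u = x + (-1 : ℝ) ^ b • (ExteriorAlgebra.ι ℝ u * y) := by
  induction t with
  | nil => exact ⟨1, 0, wedgePos_nil, rfl, zero_mem _, fun b u => by simp [expand]⟩
  | node a G R hG hR =>
    obtain ⟨x, y, hx, hl, hy, hxy⟩ := hG fun m hm => ht m (by simp [nodes, hm])
    obtain ⟨r, r', hr, hl', hr', hrr⟩ := hR fun m hm => ht m (by simp [nodes, hm])
    have ha := ht a (by simp [nodes])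
    have hx0 := hx.mem (j := 0) (d := G.size) (by omega)
    have hr0 := hr.mem (j := 0) (d := R.size) (by omega)
    obtain ⟨h1, h2, h3⟩ := ha.expand_node hx0 hy rfl
    obtain ⟨h4, h5⟩ := ha.wedgePos hx hl hy
    have hlen : (word tl' hd' (node a G R)).length = size (node a G R) := by
      simp [word, size, hl'] at h5 ⊢; omega
    refine ⟨(ExteriorAlgebra.ι ℝ (T a) * x + (x + ExteriorAlgebra.ι ℝ (T a) * y) *
        ExteriorAlgebra.ι ℝ (H a)) * r, ε a • ((x + ExteriorAlgebra.ι ℝ (T a) * y) * r) +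
        (ExteriorAlgebra.ι ℝ (T a) * x + (x + ExteriorAlgebra.ι ℝ (T a) * y) *
          ExteriorAlgebra.ι ℝ (H a)) * r', ?_, hlen, ?_, fun b u => ?_⟩
    rotate_left 2
    · rw [expand, hxy, hrr, pow_zero, one_smul, h3]
    · simpa [word, List.append_assoc] using h4.mul hr
    · refine add_mem (smul_mem_wedgeCone ha.pos.le (mul_mem_wedgeCone_of_sublist h1 hr0 ?_ ?_))
        (mul_mem_wedgeCone_of_sublist h2 hr' ?_ ?_)
      · simp [word]
      · simp [size]; omega
      · simp [word]
      · simp [size]; omega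

/-- `P a x` holds whenever `x` lies below `a`, and `L x y` whenever `x` lies in a tree to the left
of the tree of `y`. -/
def Compatible (P L : σ → σ → Prop) : Forest σ → Prop
  | nil => True
  | node a G R => (∀ x ∈ G.nodes, P a x) ∧ (∀ x ∈ a :: G.nodes, ∀ y ∈ R.nodes, L x y) ∧
      G.Compatible P L ∧ R.Compatible P L

lemma exists_expand_mul_eq {t : Forest σ} {P L : σ → σ → Prop} {c : σ}
    {E E' : ExteriorAlgebra ℝ V} (hP : t.Compatible P L) (hPc : ∀ a, P a c → hd' a = [])
    (ht : ∀ a ∈ t.nodes, a ≠ c → Selects f tl hd tl' hd' T H ε a) (hn : t.nodes.Nodup)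
    (hc : c ∈ t.nodes) (hTc : T c = 0) (hHc : H c = 0) (hεc : 0 < ε c)
    (hE : WedgePos f (tl c) (tl' c) E) (hEl : (tl' c).length = 2) (hEc : ∀ x, x * E = E * x)
    (hE' : WedgePos f (hd c) (hd' c) E') (hEl' : (hd' c).length = 2)
    (hEc' : ∀ x, x * E' = E' * x) :
    ∃ x y, x ∈ wedgeCone f (t.word tl hd) 0 (t.size + 4) ∧
      WedgePos f (t.word tl hd) (t.word tl' hd') y ∧ (t.word tl' hd').length + 1 = t.size + 4 ∧
      ∀ b u, t.expand T H ε b u * (E * E') = x + (-1 : ℝ) ^ b • (ExteriorAlgebra.ι ℝ u * y) := by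
  have hQ : ∀ x, x * (E * E') = E * E' * x := fun x => by
    rw [← mul_assoc, hEc, mul_assoc, hEc', mul_assoc]
  induction t with
  | nil => simp [nodes] at hc
  | node a G R hG hR =>
    obtain ⟨hP1, -, hP2, hP3⟩ := hP
    simp only [nodes, List.nodup_cons, List.mem_append, not_or, List.nodup_append] at hn
    obtain ⟨⟨haG, haR⟩, hnG, hnR, hGR⟩ := hn
    by_cases hca : c = a
    · subst hca
      obtain ⟨x, y, hx, hl, hy, hxy⟩ := exists_expand_eq (t := G) fun m hm =>
        ht m (by simp [nodes, hm]) (by rintro rfl; exact haG hm)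
      obtain ⟨r, r', hr, hl', hr', hrr⟩ := exists_expand_eq (t := R) fun m hm =>
        ht m (by simp [nodes, hm]) (by rintro rfl; exact haR hm)
      refine ⟨0, ε c • (E * (x * (E' * r))), zero_mem _, ((hE.mul (hx.mul (hE'.mul hr))).smul hεc),
        ?_, fun b u => ?_⟩
      · simp [word, size, hEl, hEl', hl, hl']; omega
      · have h1 : ExteriorAlgebra.ι ℝ u * (x * (ExteriorAlgebra.ι ℝ u * r')) = 0 := by
          rw [← mul_assoc x, wedgeCone_mul_ι (hx.mem (j := 0) rfl), smul_mul_assoc, mul_smul_comm,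
            mul_assoc, ← mul_assoc, ExteriorAlgebra.ι_sq_zero, zero_mul, smul_zero]
        rw [expand, hxy, hrr, hTc, hHc]
        simp only [smul_zero, zero_add, map_zero, zero_mul, add_zero, map_smul, smul_mul_assoc,
          mul_add, mul_smul_comm, h1]
        rw [hQ, smul_smul]
        have h2 : E * (x * (E' * r)) = E * E' * (x * r) := by
          rw [← mul_assoc x, hEc', mul_assoc, mul_assoc]
        rw [h2, ← mul_assoc _ (E * E'), hQ, mul_assoc (E * E')]
    · have hA := ht a (by simp [nodes]) (Ne.symm hca)
      rcases List.mem_append.1 ((List.mem_cons.1 hc).resolve_left hca) with hcG | hcR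
      · obtain ⟨x, y, hx, hy, hl, hxy⟩ := hG hP2 (fun m hm => ht m (by simp [nodes, hm])) hnG hcG
        obtain ⟨r, r', hr, hl', hr', hrr⟩ := exists_expand_eq (t := R) fun m hm =>
          ht m (by simp [nodes, hm]) (by rintro rfl; exact hGR _ hcG _ hm rfl)
        have hda := hPc a (hP1 c hcG)
        obtain ⟨hT, hTl, -⟩ : WedgePos f (tl a) (tl' a) (ExteriorAlgebra.ι ℝ (T a)) ∧
            (tl' a).length = 1 ∧ hd' a = [] := hA.select.resolve_right (by simp [hda])
        have hr0 := hr.mem (j := 0) (d := R.size) (by omega)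
        have hy0 := hy.mem (j := 1) (d := G.size + 4) (by omega)
        have hlen : (word tl' hd' (node a G R)).length + 1 = size (node a G R) + 4 := by
          simp [word, size, hda, hTl, hl']; omega
        obtain ⟨h1, h2, h3⟩ := hA.expand_node (g := G.size) hx hy0 (by rw [pow_add]; norm_num)
        refine ⟨_, ε a • ((x + ExteriorAlgebra.ι ℝ (T a) * y) * r) +
          (ExteriorAlgebra.ι ℝ (T a) * x + (x + ExteriorAlgebra.ι ℝ (T a) * y) *
            ExteriorAlgebra.ι ℝ (H a)) * r', mul_mem_wedgeCone_of_sublist h2 hr0 ?_ ?_,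
          ?_, hlen, fun b u => ?_⟩
        · simp [word]
        · simp [size]; omega
        · rw [add_comm x, add_mul, smul_add, add_assoc, mul_assoc]
          refine WedgePos.add (.smul ?_ hA.pos) ?_
          · rw [word, word, hda, List.nil_append]
            exact hT.mul (hy.mul (hr.mono (List.sublist_append_right _ _)))
          · rw [show (word tl' hd' (node a G R)).length = size (node a G R) + 3 by omega]
            refine add_mem (smul_mem_wedgeCone hA.pos.le
              (mul_mem_wedgeCone_of_sublist hx hr0 ?_ ?_))
              (mul_mem_wedgeCone_of_sublist (add_comm x _ ▸ h2) hr' ?_ ?_)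
            · simp only [word]
              exact (List.Sublist.append_left (List.sublist_append_right _ _) _).trans
                (List.sublist_append_right _ _)
            · simp [size]; omega
            · simp [word]
            · simp [size]; omega
        · rw [← h3, ← hrr, expand, mul_assoc, mul_assoc, hQ, ← mul_assoc (expand _ _ _ _ _ _), hxy,
            pow_zero, one_smul]
      · obtain ⟨r, r', hr, hr', hl', hrr⟩ := hR hP3 (fun m hm => ht m (by simp [nodes, hm])) hnR hcR
        obtain ⟨x, y, hx, hl, hy, hxy⟩ := exists_expand_eq (t := G) fun m hm =>
          ht m (by simp [nodes, hm]) (by rintro rfl; exact hGR _ hm _ hcR rfl)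
        have hx0 := hx.mem (j := 0) (d := G.size) (by omega)
        obtain ⟨h1, h2, h3⟩ := hA.expand_node hx0 hy rfl
        obtain ⟨h4, h5⟩ := hA.wedgePos hx hl hy
        have hlen : (word tl' hd' (node a G R)).length + 1 = size (node a G R) + 4 := by
          simp [word, size] at h5 ⊢; omega
        refine ⟨_, ε a • ((x + ExteriorAlgebra.ι ℝ (T a) * y) * r) +
          (ExteriorAlgebra.ι ℝ (T a) * x + (x + ExteriorAlgebra.ι ℝ (T a) * y) *
            ExteriorAlgebra.ι ℝ (H a)) * r', mul_mem_wedgeCone_of_sublist h2 hr ?_ ?_,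
          ?_, hlen, fun b u => ?_⟩
        · simp [word]
        · simp [size]; omega
        · rw [add_comm]
          refine WedgePos.add ?_ ?_
          · simpa [word, List.append_assoc] using h4.mul hr'
          · rw [show (word tl' hd' (node a G R)).length = size (node a G R) + 3 by omega]
            refine smul_mem_wedgeCone hA.pos.le (mul_mem_wedgeCone_of_sublist h1 hr ?_ ?_)
            · simp [word]
            · simp [size]; omega
        · rw [← h3, ← hrr, expand, mul_assoc, mul_assoc, hxy, pow_zero, one_smul]

lemma mem_word {t : Forest σ} {w : τ} :
    w ∈ t.word tl hd ↔ ∃ a ∈ t.nodes, w ∈ tl a ∨ w ∈ hd a := by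
  induction t with
  | nil => simp [word, nodes]
  | node a G R hG hR =>
    simp only [word, nodes, List.mem_append, hG, hR, List.mem_cons]
    constructor
    · rintro (h | ⟨x, hx, h⟩ | h | ⟨x, hx, h⟩)
      · exact ⟨a, .inl rfl, .inl h⟩
      · exact ⟨x, .inr (.inl hx), h⟩
      · exact ⟨a, .inl rfl, .inr h⟩
      · exact ⟨x, .inr (.inr hx), h⟩
    · rintro ⟨x, rfl | hx | hx, h⟩
      · exact h.imp id fun h => .inr (.inl h)
      · exact .inr (.inl ⟨x, hx, h⟩)
      · exact .inr (.inr (.inr ⟨x, hx, h⟩))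

lemma pairwise_word {t : Forest σ} {P L : σ → σ → Prop} {r : τ → τ → Prop}
    (ht : t.Compatible P L)
    (htl : ∀ a, (tl a).Pairwise r) (hhd : ∀ a, (hd a).Pairwise r)
    (hth : ∀ a, ∀ v ∈ tl a, ∀ w ∈ hd a, r v w)
    (hP₁ : ∀ a x, P a x → ∀ v ∈ tl a, ∀ w, w ∈ tl x ∨ w ∈ hd x → r v w)
    (hP₂ : ∀ a x, P a x → ∀ v, v ∈ tl x ∨ v ∈ hd x → ∀ w ∈ hd a, r v w)
    (hL : ∀ x y, L x y → ∀ v, v ∈ tl x ∨ v ∈ hd x → ∀ w, w ∈ tl y ∨ w ∈ hd y → r v w) :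
    (t.word tl hd).Pairwise r := by
  induction t with
  | nil => exact List.Pairwise.nil
  | node a G R hG hR =>
    obtain ⟨h1, h2, h3, h4⟩ := ht
    simp only [word, List.pairwise_append]
    refine ⟨htl a, ⟨hG h3, ⟨hhd a, hR h4, fun v hv w hw => ?_⟩, fun v hv w hw => ?_⟩,
      fun v hv w hw => ?_⟩
    · obtain ⟨y, hy, hw⟩ := mem_word.1 hw
      exact hL a y (h2 a (by simp) y hy) v (.inr hv) w hw
    · obtain ⟨x, hx, hv⟩ := mem_word.1 hv
      rcases List.mem_append.1 hw with hw | hw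
      · exact hP₂ a x (h1 x hx) v hv w hw
      · obtain ⟨y, hy, hw⟩ := mem_word.1 hw
        exact hL x y (h2 x (by simp [hx]) y hy) v hv w hw
    · rcases List.mem_append.1 hw with hw | hw
      · obtain ⟨x, hx, hw⟩ := mem_word.1 hw
        exact hP₁ a x (h1 x hx) v hv w hw
      · rcases List.mem_append.1 hw with hw | hw
        · exact hth a v hv w hw
        · obtain ⟨y, hy, hw⟩ := mem_word.1 hw
          exact hL a y (h2 a (by simp) y hy) v (.inl hv) w hw

end Forest

end Forests

section Keys

variable {V : Type*} [AddCommGroup V] [Module ℝ V] {σ : Type*} {e : ℕ → V}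

lemma sublist_range' {p : ℕ} {s : List ℕ} (hs : s.Pairwise (· < ·)) (h : ∀ a ∈ s, 1 ≤ a ∧ a ≤ p) :
    s.Sublist (List.range' 1 p) := by
  refine List.sublist_of_subperm_of_pairwise (r := (· < ·))
    (List.subperm_of_subset (hs.imp Nat.ne_of_lt) fun a ha => ?_) hs List.pairwise_lt_range'
  have := h a ha
  rw [List.mem_range'_1]
  omega

lemma wedgeCone_range'_mono {x : ExteriorAlgebra ℝ V} {q p d : ℕ} (h : q ≤ p)
    (hx : x ∈ wedgeCone e (List.range' 1 q) 0 d) :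
    x ∈ wedgeCone e (List.range' 1 p) 0 d :=
  wedgeCone_mono ((List.range'_sublist_right).2 h) rfl hx

lemma mul_ι_mem_wedgeCone {x : ExteriorAlgebra ℝ V} {q p d : ℕ} (hp : 1 ≤ p) (hqp : q ≤ p)
    (hx : x ∈ wedgeCone e (List.range' 1 q) 0 d) :
    x * ExteriorAlgebra.ι ℝ (e p) ∈ wedgeCone e (List.range' 1 p) 0 (d + 1) := by
  have hp' : List.range' 1 p = List.range' 1 (p - 1) ++ [p] := by
    obtain ⟨p, rfl⟩ := Nat.exists_eq_add_of_le' hp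
    rw [List.range'_concat]; simp [add_comm]
  refine wedgeCone_induction (p := fun z => z * ExteriorAlgebra.ι ℝ (e p) ∈
      wedgeCone e (List.range' 1 p) 0 (d + 1)) (fun s hs hd => ?_) ?_ (fun a b ha hb => ?_)
      (fun c a hc ha => ?_) (wedgeCone_range'_mono hqp hx)
  · rw [hp'] at hs ⊢
    obtain ⟨s₁, s₂, rfl, h₁, h₂⟩ := List.sublist_append_iff.1 hs
    rcases List.sublist_singleton.1 h₂ with rfl | rfl
    · have h3 := wedge_mem_wedgeCone (f := e) (j := 0) (d := d + 1)
        (h₁.append (List.Sublist.refl [p])) (by simpa using hd)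
      simpa using h3
    · simp [mul_assoc]
  · rw [zero_mul]; exact zero_mem _
  · rw [add_mul]; exact add_mem ha hb
  · rw [smul_mul_assoc]; exact smul_mem_wedgeCone hc ha

lemma WedgePos.mul_ι {x : ExteriorAlgebra ℝ V} {q p : ℕ} {s : List ℕ}
    (hqp : q ≤ p) (hx : WedgePos e (List.range' 1 q) s x)
    (hs : (s ++ [p]).Pairwise (· < ·)) (hp : 1 ≤ p) :
    WedgePos e (List.range' 1 p) (s ++ [p]) (x * ExteriorAlgebra.ι ℝ (e p)) := by
  obtain ⟨hsl, c, hc, y, hy, rfl⟩ := hx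
  refine ⟨sublist_range' hs fun a ha => ?_, c, hc, y * ExteriorAlgebra.ι ℝ (e p), ?_, ?_⟩
  · rcases List.mem_append.1 ha with h | h
    · have := List.mem_range'_1.1 (hsl.subset h)
      omega
    · simp at h; omega
  · rw [List.length_append]
    exact mul_ι_mem_wedgeCone hp hqp hy
  · simp [add_mul]

variable {pos : σ → ℕ} {a b : σ → ℝ} {f : σ → V}

/-- The relation between successive keys which makes the exterior product of their vectors
a nonnegative combination of exterior products of the vectors `e`. -/
def KeyLE (pos : σ → ℕ) (a b : σ → ℝ) (t t' : σ) : Prop :=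
  pos t < pos t' ∨ (pos t = pos t' ∧ b t * a t' ≤ a t * b t')

lemma ι_mul_ι_of_pos_eq (hf : ∀ t, f t = a t • e (pos t) + b t • e (pos t + 1)) {t t' : σ}
    (h : pos t = pos t') :
    ExteriorAlgebra.ι ℝ (f t) * ExteriorAlgebra.ι ℝ (f t') = (a t * b t' - b t * a t') •
      (ExteriorAlgebra.ι ℝ (e (pos t)) * ExteriorAlgebra.ι ℝ (e (pos t + 1))) := by
  have h1 := eq_neg_of_add_eq_zero_left
    (ExteriorAlgebra.ι_add_mul_swap (R := ℝ) (e (pos t + 1)) (e (pos t)))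
  rw [hf, hf, ← h]
  simp only [map_add, map_smul, add_mul, mul_add, smul_mul_assoc, mul_smul_comm, h1,
    ExteriorAlgebra.ι_sq_zero, smul_zero, smul_neg, sub_smul]
  module

lemma mul_wedge_mem_wedgeCone {x : ExteriorAlgebra ℝ V} {q d n : ℕ}
    (hf : ∀ t, f t = a t • e (pos t) + b t • e (pos t + 1))
    (l : List σ) (hl : l.Pairwise (KeyLE pos a b)) (hab : ∀ t ∈ l, 0 ≤ a t ∧ 0 ≤ b t)
    (hpos : ∀ t ∈ l, q ≤ pos t ∧ 1 ≤ pos t ∧ pos t + 1 ≤ n) (hq : q ≤ n)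
    (hx : x ∈ wedgeCone e (List.range' 1 q) 0 d) :
    x * wedge (l.map f) ∈ wedgeCone e (List.range' 1 n) 0 (d + l.length) := by
  match l, hl, hab, hpos with
  | [], _, _, _ => simpa using wedgeCone_range'_mono hq hx
  | t :: l, hl, hab, hpos =>
    obtain ⟨hl₁, hl₂⟩ := List.pairwise_cons.1 hl
    obtain ⟨hq1, hp1, hn1⟩ := hpos t (by simp)
    obtain ⟨ha, hb⟩ := hab t (by simp)
    have h1 := mul_ι_mem_wedgeCone hp1 hq1 hx
    by_cases h : ∀ t' ∈ l, pos t + 1 ≤ pos t'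
    · have h2 := mul_ι_mem_wedgeCone (p := pos t + 1) (by omega) (by omega) hx
      have h3 : x * ExteriorAlgebra.ι ℝ (f t) ∈
          wedgeCone e (List.range' 1 (pos t + 1)) 0 (d + 1) := by
        rw [hf, map_add, map_smul, map_smul, mul_add, mul_smul_comm, mul_smul_comm]
        exact add_mem (smul_mem_wedgeCone ha (wedgeCone_range'_mono (by omega) h1))
          (smul_mem_wedgeCone hb h2)
      have h4 := mul_wedge_mem_wedgeCone hf l hl₂ (fun t' ht' => hab t' (by simp [ht']))
        (fun t' ht' => ⟨h t' ht', (hpos t' (by simp [ht'])).2⟩) hn1 h3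
      rw [List.map_cons, wedge_cons, ← mul_assoc, List.length_cons, add_comm l.length, ← add_assoc]
      exact h4
    · match l, hl₁, hl₂, h with
      | [], _, _, h => simp at h
      | t' :: l, hl₁, hl₂, h =>
        obtain ⟨hl₃, hl₄⟩ := List.pairwise_cons.1 hl₂
        have h0 := hl₁ t' (by simp)
        have htt' : pos t = pos t' := by
          push Not at h
          obtain ⟨t₁, h₁, h₂⟩ := h
          rcases List.mem_cons.1 h₁ with rfl | h₁
          · rcases h0 with h0 | h0 <;> omega
          · rcases hl₃ t₁ h₁ with h3 | h3 <;> rcases h0 with h0 | h0 <;> omega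
        have hdet : 0 ≤ a t * b t' - b t * a t' := by
          rcases h0 with h0 | h0
          · omega
          · linarith [h0.2]
        have h3 := mul_ι_mem_wedgeCone (p := pos t + 1) (by omega) (by omega) h1
        rw [List.map_cons, wedge_cons, List.map_cons, wedge_cons,
          ← mul_assoc (ExteriorAlgebra.ι ℝ _),
          ι_mul_ι_of_pos_eq hf htt', smul_mul_assoc, mul_smul_comm]
        refine smul_mem_wedgeCone hdet ?_
        match l, hl₃, hl₄, hpos, hab with
        | [], _, _, _, _ =>
          simpa [mul_assoc] using wedgeCone_range'_mono hn1 h3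
        | t₁ :: l, hl₃, hl₄, hpos, hab =>
          obtain ⟨hl₅, hl₆⟩ := List.pairwise_cons.1 hl₄
          by_cases h5 : pos t = pos t₁
          · have h6 : ExteriorAlgebra.ι ℝ (e (pos t)) * ExteriorAlgebra.ι ℝ (e (pos t + 1)) *
                wedge ((t₁ :: l).map f) = 0 := by
              have h1 := eq_neg_of_add_eq_zero_left
                (ExteriorAlgebra.ι_add_mul_swap (R := ℝ) (e (pos t + 1)) (e (pos t)))
              rw [List.map_cons, wedge_cons, ← mul_assoc, hf, ← h5, map_add, map_smul, map_smul,
                mul_add, mul_smul_comm, mul_smul_comm,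
                mul_assoc _ _ (ExteriorAlgebra.ι ℝ (e (pos t))),
                h1, mul_neg, mul_assoc _ _ (ExteriorAlgebra.ι ℝ (e (pos t + 1))), ← mul_assoc,
                ExteriorAlgebra.ι_sq_zero, ExteriorAlgebra.ι_sq_zero]
              simp
            rw [h6, mul_zero]
            exact zero_mem _
          · have h4 := mul_wedge_mem_wedgeCone hf (t₁ :: l) hl₄
              (fun t' ht' => hab t' (by simp_all))
              (fun t₂ ht' => ⟨?_, (hpos t₂ (by simp_all)).2⟩) hn1 h3
            · rw [← mul_assoc, ← mul_assoc]
              have h6 : d + (t :: t' :: t₁ :: l).length = d + 1 + 1 + (t₁ :: l).length := by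
                simp only [List.length_cons]; omega
              rw [h6]
              exact h4
            · have h7 : pos t + 1 ≤ pos t₁ := by
                rcases hl₁ t₁ (by simp) with h | h <;> omega
              rcases List.mem_cons.1 ht' with rfl | ht'
              · exact h7
              · rcases hl₅ _ ht' with h | h <;> omega
termination_by l.length

lemma WedgePos.mul_wedge {x : ExteriorAlgebra ℝ V} {q n : ℕ} {s : List ℕ}
    (hf : ∀ t, f t = a t • e (pos t) + b t • e (pos t + 1)) {g : σ → ℕ}
    (l : List σ) (hl : l.Pairwise fun t t' => pos t = pos t' → b t * a t' < a t * b t')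
    (hab : ∀ t ∈ l, 0 ≤ a t ∧ 0 ≤ b t)
    (hg : ∀ t ∈ l, (g t = pos t ∧ 0 < a t) ∨ (g t = pos t + 1 ∧ 0 < b t))
    (hpos : ∀ t ∈ l, q ≤ pos t ∧ 1 ≤ pos t ∧ pos t + 1 ≤ n) (hq : q ≤ n)
    (hx : WedgePos e (List.range' 1 q) s x) (hs : (s ++ l.map g).Pairwise (· < ·)) :
    WedgePos e (List.range' 1 n) (s ++ l.map g) (x * wedge (l.map f)) := by
  match l, hl, hab, hpos, hg, hs with
  | [], _, _, _, _, _ =>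
    simpa using hx.mono ((List.range'_sublist_right).2 hq)
  | t :: l, hl, hab, hpos, hg, hs =>
    obtain ⟨hl₁, hl₂⟩ := List.pairwise_cons.1 hl
    obtain ⟨hq1, hp1, hn1⟩ := hpos t (by simp)
    obtain ⟨ha, hb⟩ := hab t (by simp)
    have hs' : ((s ++ [g t]) ++ l.map g).Pairwise (· < ·) := by simpa using hs
    have hs₁ := (List.pairwise_append.1 hs').1
    have hx0 := hx.mem (j := 0) (d := s.length) rfl
    have hgl : ∀ t' ∈ l, g t < g t' := fun t' ht' =>
      (List.pairwise_append.1 hs').2.2 _ (by simp) _ (by simpa using ⟨t', ht', rfl⟩)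
    by_cases h : ∀ t' ∈ l, pos t + 1 ≤ pos t'
    · have h3 : WedgePos e (List.range' 1 (pos t + 1)) (s ++ [g t])
          (x * ExteriorAlgebra.ι ℝ (f t)) := by
        rw [hf, map_add, map_smul, map_smul, mul_add, mul_smul_comm, mul_smul_comm]
        rcases hg t (by simp) with ⟨h4, h5⟩ | ⟨h4, h5⟩
        · refine WedgePos.add (.smul ?_ h5) (smul_mem_wedgeCone hb ?_)
          · rw [h4] at hs₁ ⊢
            exact (hx.mul_ι hq1 hs₁ hp1).mono ((List.range'_sublist_right).2 (by omega))
          · rw [List.length_append]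
            exact mul_ι_mem_wedgeCone (by omega) (by omega) hx0
        · rw [add_comm (a t • _)]
          refine WedgePos.add (.smul ?_ h5) (smul_mem_wedgeCone ha ?_)
          · rw [h4] at hs₁ ⊢
            exact hx.mul_ι (by omega) hs₁ (by omega)
          · rw [List.length_append]
            exact wedgeCone_range'_mono (by omega) (mul_ι_mem_wedgeCone hp1 hq1 hx0)
      have h4 := WedgePos.mul_wedge hf l hl₂ (fun t' ht' => hab t' (by simp [ht']))
        (fun t' ht' => hg t' (by simp [ht']))
        (fun t' ht' => ⟨h t' ht', (hpos t' (by simp [ht'])).2⟩) hn1 h3 hs'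
      rw [List.map_cons (f := f), wedge_cons, ← mul_assoc]
      simpa using h4
    · match l, hl₁, hl₂, h, hs', hgl with
      | [], _, _, h, _, _ => simp at h
      | t' :: l, hl₁, hl₂, h, hs', hgl =>
        obtain ⟨hl₃, hl₄⟩ := List.pairwise_cons.1 hl₂
        have hs'' : ((s ++ [g t] ++ [g t']) ++ l.map g).Pairwise (· < ·) := by simpa using hs
        have hgl' : ∀ t₁ ∈ l, g t' < g t₁ := fun t₁ ht' =>
          (List.pairwise_append.1 hs'').2.2 _ (by simp) _ (by simpa using ⟨t₁, ht', rfl⟩)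
        have hgt := hgl t' (by simp)
        have hgt' := hg t' (by simp)
        have hg₀ := hg t (by simp)
        have key : g t = pos t ∧ g t' = pos t + 1 ∧ pos t = pos t' := by
          push Not at h
          obtain ⟨t₁, h₁, h₂⟩ := h
          rcases List.mem_cons.1 h₁ with rfl | h₁
          · rcases hg₀ with ⟨h4, -⟩ | ⟨h4, -⟩ <;> rcases hgt' with ⟨h5, -⟩ | ⟨h5, -⟩ <;> omega
          · have h6 := hgl' t₁ h₁
            rcases hg₀ with ⟨h4, -⟩ | ⟨h4, -⟩ <;>
              rcases hg t₁ (by simp [h₁]) with ⟨h7, -⟩ | ⟨h7, -⟩ <;> omega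
        obtain ⟨hg1, hg2, htt'⟩ := key
        rw [hg1] at hs₁
        have h1 := hx.mul_ι hq1 hs₁ hp1
        have hs₃ := (List.pairwise_append.1 hs'').1
        rw [hg1, hg2] at hs₃
        have h3 : WedgePos e (List.range' 1 (pos t + 1)) (s ++ [g t] ++ [g t'])
            (x * ExteriorAlgebra.ι ℝ (e (pos t)) * ExteriorAlgebra.ι ℝ (e (pos t + 1))) := by
          rw [hg1, hg2]
          exact h1.mul_ι (Nat.le_succ _) hs₃ (by omega)
        have hdet : 0 < a t * b t' - b t * a t' := by
          linarith [hl₁ t' (by simp) htt']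
        rw [List.map_cons (f := f), wedge_cons, List.map_cons (f := f), wedge_cons,
          ← mul_assoc (ExteriorAlgebra.ι ℝ _), ι_mul_ι_of_pos_eq hf htt', smul_mul_assoc,
          mul_smul_comm]
        refine WedgePos.smul ?_ hdet
        have h4 := WedgePos.mul_wedge hf l hl₄
          (fun t' ht' => hab t' (by simp_all)) (fun t' ht' => hg t' (by simp [ht']))
          (fun t₂ ht' => ⟨?_, (hpos t₂ (by simp_all)).2⟩) hn1 h3 hs''
        · simpa [mul_assoc] using h4
        · have := hgl' t₂ ht'
          rcases hg t₂ (by simp [ht']) with h7 | h7 <;> omega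
termination_by l.length

end Keys

namespace ChordDiagram

variable {n k : ℕ} (D : ChordDiagram n k)

lemma descendant_iff {l m : Fin k} : D.Descendant l m ↔ l < m ∧ D.tail m < D.head l := by
  unfold Descendant
  rw [D.tail_strictMono.lt_iff_lt]
  refine and_congr_right fun h => ⟨fun h' => ?_, fun h' => ?_⟩
  · have := D.tail_add_two_le_head m
    omega
  · by_contra h''
    exact D.noncrossing l m h ⟨h', by omega⟩

variable {D}

lemma Descendant.lt {l m : Fin k} (h : D.Descendant l m) : l < m := (D.descendant_iff.1 h).1

lemma Descendant.trans {l m p : Fin k} (h : D.Descendant l m) (h' : D.Descendant m p) :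
    D.Descendant l p := ⟨h.1.trans h'.1, h'.2.trans h.2⟩

lemma head_le_tail {l m : Fin k} (h : l < m) (h' : ¬ D.Descendant l m) : D.head l ≤ D.tail m := by
  rw [descendant_iff] at h'
  by_contra h''
  exact h' ⟨h, by omega⟩

lemma descendant_iff_le {l m : Fin k} : D.Descendant l m ↔ l < m ∧ (m : ℕ) ≤ l + D.below l := by
  refine ⟨fun h => ⟨h.lt, ?_⟩, fun ⟨h, h'⟩ => ?_⟩
  · have h1 : Finset.Ioc l m ⊆ Finset.univ.filter fun m => D.Descendant l m := fun x hx => by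
      rw [Finset.mem_Ioc] at hx
      rw [Finset.mem_filter, descendant_iff]
      exact ⟨Finset.mem_univ _, hx.1,
        (D.tail_strictMono.monotone hx.2).trans_lt (D.descendant_iff.1 h).2⟩
    have h2 := Finset.card_le_card h1
    rw [Fin.card_Ioc] at h2
    unfold below
    omega
  · by_contra h''
    have h1 : (Finset.univ.filter fun m => D.Descendant l m) ⊆ Finset.Ioo l m := fun x hx => by
      rw [Finset.mem_filter] at hx
      rw [Finset.mem_Ioo]
      refine ⟨hx.2.lt, ?_⟩
      by_contra hx'
      refine h'' (D.descendant_iff.2 ⟨h, ?_⟩)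
      exact (D.tail_strictMono.monotone (not_lt.1 hx')).trans_lt (D.descendant_iff.1 hx.2).2
    have h2 := Finset.card_le_card h1
    rw [Fin.card_Ioo] at h2
    unfold below at h'
    rw [Fin.lt_def] at h
    omega

lemma beyond_eq_of_descendant {a l : Fin k} (h : D.Descendant a l) :
    D.beyond l a = (l : ℕ) - a - 1 := by
  rw [← Fin.card_Ioo]
  unfold beyond
  congr 1
  ext x
  rw [Finset.mem_filter, Finset.mem_Ioo, D.tail_strictMono.lt_iff_lt]
  refine ⟨fun hx => ⟨hx.2.1.lt, hx.2.2⟩, fun hx => ⟨Finset.mem_univ _, ?_, hx.2⟩⟩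
  exact D.descendant_iff.2 ⟨hx.1, (D.tail_strictMono hx.2).trans (D.descendant_iff.1 h).2⟩

lemma behind_eq (l : Fin k) : D.behind l = k - 1 - l := by
  rw [← Fin.card_Ioi]
  unfold behind
  congr 1
  ext x
  simp [D.tail_strictMono.lt_iff_lt]

variable (D)

/-- The forest `t` is part of the forest of chords of `D` under the parent relation, below the
chord `par`, where `b` chords precede `t`. -/
def Fits : ℕ → Option (Fin k) → Forest (Fin k) → Prop
  | _, _, .nil => True
  | b, par, .node m G R => D.below m = G.size ∧
      (par = none → D.IsTop m ∧ b = m) ∧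
      (∀ a, par = some a → D.IsParent a m ∧ D.beyond m a = b) ∧
      Fits 0 (some m) G ∧ Fits (b + G.size + 1) par R

variable {D}

lemma exists_forest_of_interval (d : ℕ) : ∀ (p q b : ℕ) (par : Option (Fin k)), p + d = q → q ≤ k →
    (∀ x y : Fin k, p ≤ x → (x : ℕ) < q → D.Descendant x y → (y : ℕ) < q) →
    (par = none → b = p ∧ ∀ a x : Fin k, p ≤ x → (x : ℕ) < q → D.Descendant a x → p ≤ a) →
    (∀ a, par = some a → p = a + 1 + b ∧ ∀ x : Fin k, p ≤ x → (x : ℕ) < q → D.Descendant a x ∧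
      ∀ a', D.Descendant a' x → p ≤ a' ∨ a' ≤ a) →
    ∃ t : Forest (Fin k), t.Compatible D.Descendant (fun x y => D.head x ≤ D.tail y) ∧
      D.Fits b par t ∧ t.nodes.map Fin.val = List.range' p d := by
  induction d using Nat.strong_induction_on with
  | _ d ih =>
  intro p q b par hpq hq hcl hnone hsome
  rcases Nat.eq_zero_or_pos d with rfl | hd
  · exact ⟨.nil, trivial, trivial, rfl⟩
  · obtain ⟨m, hm⟩ : ∃ m : Fin k, (m : ℕ) = p := ⟨⟨p, by omega⟩, rfl⟩
    have hbelow : p + 1 + D.below m ≤ q := by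
      by_contra h
      rcases Nat.lt_or_ge q k with hqk | hqk
      · have := hcl m ⟨q, hqk⟩ hm.ge (by omega)
          (descendant_iff_le.2 ⟨Fin.lt_def.2 (by simp; omega), by simp; omega⟩)
        simp at this
      · have h1 : D.below m ≤ k - 1 - m := by
          rw [← D.behind_eq]
          exact Finset.card_le_card (Finset.monotone_filter_right _ fun _ _ h => h.1)
        omega
    have hdesc : ∀ x : Fin k, D.Descendant m x ↔ p + 1 ≤ x ∧ (x : ℕ) < p + 1 + D.below m := by
      intro x
      rw [descendant_iff_le, Fin.lt_def]
      omega
    have hout : ∀ a x : Fin k, p ≤ a → p + 1 + D.below m ≤ x → D.Descendant a x →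
        p + 1 + D.below m ≤ a := by
      intro a x ha hx hax
      by_contra h
      rcases ha.eq_or_lt with ha | ha
      · obtain rfl : a = m := Fin.ext (by omega)
        have := (hdesc x).1 hax
        omega
      · have := (hdesc x).1 (((hdesc a).2 (by omega)).trans hax)
        omega
    obtain ⟨G, hG1, hG2, hG3⟩ := ih (D.below m) (by omega) (p + 1) (p + 1 + D.below m) 0 (some m)
      rfl (by omega) (fun x y hx hx' hxy => ((hdesc y).1 (((hdesc x).2 ⟨hx, hx'⟩).trans hxy)).2)
      (by simp) (by
        rintro a ⟨⟩
        refine ⟨by omega, fun x hx hx' => ⟨(hdesc x).2 ⟨hx, hx'⟩, fun a' _ => ?_⟩⟩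
        rw [Fin.le_def]; omega)
    obtain ⟨R, hR1, hR2, hR3⟩ := ih (d - 1 - D.below m) (by omega) (p + 1 + D.below m) q
      (b + D.below m + 1) par (by omega) hq
      (fun x y hx hx' hxy => hcl x y (by omega) hx' hxy) (fun h => by
        obtain ⟨h1, h2⟩ := hnone h
        exact ⟨by omega, fun a x hx hx' hax => hout a x (h2 a x (by omega) hx' hax) hx hax⟩)
      (fun a h => by
        obtain ⟨h1, h2⟩ := hsome a h
        refine ⟨by omega, fun x hx hx' => ?_⟩
        obtain ⟨h3, h4⟩ := h2 x (by omega) hx'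
        exact ⟨h3, fun a' ha' => (h4 a' ha').imp_left fun h => hout a' x h hx ha'⟩)
    have hGn : ∀ x ∈ G.nodes, D.Descendant m x := fun x hx => by
      have h := List.mem_map_of_mem (f := Fin.val) hx
      rw [hG3, List.mem_range'_1] at h
      exact (hdesc x).2 (by omega)
    have hsize : D.below m = G.size := by
      rw [← G.length_nodes, ← List.length_map (f := Fin.val), hG3, List.length_range']
    have hmR : ∀ y ∈ R.nodes, D.head m ≤ D.tail y := fun y hy => by
      have h := List.mem_map_of_mem (f := Fin.val) hy
      rw [hR3, List.mem_range'_1] at h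
      refine head_le_tail (Fin.lt_def.2 (by omega)) fun h' => ?_
      have := (hdesc y).1 h'
      omega
    refine ⟨.node m G R, ⟨hGn, fun x hx y hy => ?_, hG1, hR1⟩, ⟨hsize, fun h => ?_, fun a h => ?_,
      hG2, hsize ▸ hR2⟩, ?_⟩
    · rcases List.mem_cons.1 hx with rfl | hx
      · exact hmR y hy
      · exact (hGn x hx).2.trans (hmR y hy)
    · obtain ⟨h1, h2⟩ := hnone h
      refine ⟨fun a ha => ?_, by omega⟩
      have := h2 a m (by omega) (by omega) ha
      have := Fin.lt_def.1 ha.lt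
      omega
    · obtain ⟨h1, h2⟩ := hsome a h
      obtain ⟨h3, h4⟩ := h2 m (by omega) (by omega)
      refine ⟨⟨h3, fun a' ha' => ?_⟩, ?_⟩
      · refine D.tail_strictMono.monotone ((h4 a' ha').resolve_left fun h => ?_)
        have := Fin.lt_def.1 ha'.lt
        omega
      · rw [beyond_eq_of_descendant h3]
        omega
    · rw [Forest.nodes, List.map_cons, List.map_append, hG3, hR3, hm, List.range'_append_1,
        ← List.range'_succ]
      congr 1
      omega

variable (D) in
lemma exists_forest : ∃ t : Forest (Fin k),
    t.Compatible D.Descendant (fun x y => D.head x ≤ D.tail y) ∧ D.Fits 0 none t ∧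
      t.nodes = List.finRange k := by
  obtain ⟨t, h1, h2, h3⟩ := exists_forest_of_interval (D := D) k 0 k 0 none (by omega) le_rfl
    (fun _ y _ _ _ => y.2) (fun _ => ⟨rfl, fun _ _ _ _ _ => Nat.zero_le _⟩) (by simp)
  refine ⟨t, h1, h2, List.map_injective_iff.2 Fin.val_injective ?_⟩
  rw [h3, List.map_coe_finRange_eq_range, List.range_eq_range']

end ChordDiagram

/-- Labels for the two-term vectors occurring in the rows: `tail m` and `head m` stand for the
contributions of the two ends of the chord `m`, `lo q` and `hi q` for the markers `q` and
`q + 1`. -/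
inductive RowKey (k : ℕ)
  | tail (m : Fin k) : RowKey k
  | head (m : Fin k) : RowKey k
  | lo (q : ℕ) : RowKey k
  | hi (q : ℕ) : RowKey k

namespace ChordDiagram

variable {n k : ℕ} (D : ChordDiagram n k) (α β γ δ : Fin k → ℝ) (c : Fin k)

/-- `0` at the four markers of the chord `c`, and `1` elsewhere. -/
def keep (q : ℕ) : ℝ :=
  if q = D.tail c ∨ q = D.tail c + 1 ∨ q = D.head c ∨ q = D.head c + 1 then 0 else 1

/-- The first marker of a key. -/
def keyPos : RowKey k → ℕ
  | .tail m => D.tail m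
  | .head m => D.head m
  | .lo q => q
  | .hi q => q

/-- The coefficient at the first marker of a key. -/
def keyFst : RowKey k → ℝ
  | .tail m => α m * D.keep c (D.tail m)
  | .head m => |γ m| * D.keep c (D.head m)
  | .lo _ => 1
  | .hi _ => 0

/-- The coefficient at the second marker of a key. -/
def keySnd : RowKey k → ℝ
  | .tail m => β m * D.keep c (D.tail m + 1)
  | .head m => |δ m| * D.keep c (D.head m + 1)
  | .lo _ => 0
  | .hi _ => 1

/-- The marker of a key selected for the distinguished monomial. -/
def keyMark : RowKey k → ℕ
  | .tail m => if D.tail m < D.tail c then D.tail m else D.tail m + 1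
  | .head m => D.head m
  | .lo q => q
  | .hi q => q + 1

/-- The keys of the tail of `m`. -/
def tailKeys (m : Fin k) : List (RowKey k) :=
  if m = c then [.lo (D.tail c), .hi (D.tail c)] else [.tail m]

/-- The keys of the head of `m`. -/
def headKeys (m : Fin k) : List (RowKey k) :=
  if m = c then [.lo (D.head c), .hi (D.head c)] else [.head m]

/-- The keys of the tail of `m` selected for the distinguished monomial. -/
def tailSel (m : Fin k) : List (RowKey k) :=
  if m = c then [.lo (D.tail c), .hi (D.tail c)] else if D.tail m = D.head c then [] else [.tail m]

/-- The keys of the head of `m` selected for the distinguished monomial. -/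
def headSel (m : Fin k) : List (RowKey k) :=
  if m = c then [.lo (D.head c), .hi (D.head c)] else if D.tail m = D.head c then [.head m] else []

variable {D α β γ δ c}

lemma keep_nonneg (q : ℕ) : 0 ≤ D.keep c q := by
  unfold keep; split_ifs <;> norm_num

lemma tail_ne {m : Fin k} (h : m ≠ c) : D.tail m ≠ D.tail c :=
  fun h' => h (D.tail_strictMono.injective h')

lemma mem_tailKeys {m : Fin k} {u : RowKey k} (h : u ∈ D.tailKeys c m) :
    (m = c ∧ (u = .lo (D.tail c) ∨ u = .hi (D.tail c))) ∨ (m ≠ c ∧ u = .tail m) := by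
  unfold tailKeys at h; split_ifs at h <;> simp_all

lemma mem_headKeys {m : Fin k} {u : RowKey k} (h : u ∈ D.headKeys c m) :
    (m = c ∧ (u = .lo (D.head c) ∨ u = .hi (D.head c))) ∨ (m ≠ c ∧ u = .head m) := by
  unfold headKeys at h; split_ifs at h <;> simp_all

lemma mem_tailSel {m : Fin k} {u : RowKey k} (h : u ∈ D.tailSel c m) :
    (m = c ∧ (u = .lo (D.tail c) ∨ u = .hi (D.tail c))) ∨
      (m ≠ c ∧ D.tail m ≠ D.head c ∧ u = .tail m) := by
  unfold tailSel at h; split_ifs at h <;> simp_all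

lemma mem_headSel {m : Fin k} {u : RowKey k} (h : u ∈ D.headSel c m) :
    (m = c ∧ (u = .lo (D.head c) ∨ u = .hi (D.head c))) ∨
      (m ≠ c ∧ D.tail m = D.head c ∧ u = .head m) := by
  unfold headSel at h; split_ifs at h <;> simp_all

lemma keyPos_of_mem_tailKeys {m : Fin k} {u : RowKey k} (h : u ∈ D.tailKeys c m) :
    D.keyPos u = D.tail m := by
  rcases mem_tailKeys h with ⟨rfl, rfl | rfl⟩ | ⟨-, rfl⟩ <;> rfl

lemma keyPos_of_mem_headKeys {m : Fin k} {u : RowKey k} (h : u ∈ D.headKeys c m) :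
    D.keyPos u = D.head m := by
  rcases mem_headKeys h with ⟨rfl, rfl | rfl⟩ | ⟨-, rfl⟩ <;> rfl

lemma tailSel_sublist (m : Fin k) : (D.tailSel c m).Sublist (D.tailKeys c m) := by
  unfold tailSel tailKeys; split_ifs <;> simp

lemma headSel_sublist (m : Fin k) : (D.headSel c m).Sublist (D.headKeys c m) := by
  unfold headSel headKeys; split_ifs <;> simp

lemma keyMark_tailSel {m : Fin k} {u : RowKey k} (h : u ∈ D.tailSel c m) :
    (m = c ∧ (D.keyMark c u = D.tail c ∨ D.keyMark c u = D.tail c + 1)) ∨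
      (m ≠ c ∧ D.tail m < D.tail c ∧ D.keyMark c u = D.tail m) ∨
      (m ≠ c ∧ D.tail c < D.tail m ∧ D.tail m ≠ D.head c ∧ D.keyMark c u = D.tail m + 1) := by
  rcases mem_tailSel h with ⟨rfl, rfl | rfl⟩ | ⟨h1, h2, rfl⟩
  · simp [keyMark]
  · simp [keyMark]
  · have := tail_ne (D := D) h1
    simp only [keyMark]
    split_ifs with h3
    · exact .inr (.inl ⟨h1, h3, rfl⟩)
    · exact .inr (.inr ⟨h1, by omega, h2, rfl⟩)

lemma keyMark_headSel {m : Fin k} {u : RowKey k} (h : u ∈ D.headSel c m) :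
    (m = c ∧ (D.keyMark c u = D.head c ∨ D.keyMark c u = D.head c + 1)) ∨
      (m ≠ c ∧ D.tail m = D.head c ∧ D.keyMark c u = D.head m) := by
  rcases mem_headSel h with ⟨rfl, rfl | rfl⟩ | ⟨h1, h2, rfl⟩
  · simp [keyMark]
  · simp [keyMark]
  · exact .inr ⟨h1, h2, rfl⟩

lemma pairwise_keyMark {t : Forest (Fin k)}
    (ht : t.Compatible D.Descendant fun x y => D.head x ≤ D.tail y) :
    (t.word (D.tailSel c) (D.headSel c)).Pairwise fun v w => D.keyMark c v < D.keyMark c w := by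
  have hc := D.tail_add_two_le_head c
  refine Forest.pairwise_word ht (fun a => ?_) (fun a => ?_) (fun a v hv w hw => ?_)
    (fun a x hax v hv w hw => ?_) (fun a x hax v hv w hw => ?_) (fun x y hxy v hv w hw => ?_)
  · unfold tailSel; split_ifs <;> simp [keyMark]
  · unfold headSel; split_ifs <;> simp [keyMark]
  · have h1 := keyMark_tailSel hv
    have h2 := keyMark_headSel hw
    omega
  · have h1 := keyMark_tailSel hv
    have h2 := hw.imp keyMark_tailSel keyMark_headSel
    have h3 := D.tail_add_two_le_head x
    obtain ⟨h4, h5⟩ := hax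
    have h6 : a = c → D.tail a = D.tail c := fun h => by rw [h]
    have h7 : x = c → D.tail x = D.tail c := fun h => by rw [h]
    omega
  · have h1 := keyMark_headSel hw
    have h2 := hv.imp keyMark_tailSel keyMark_headSel
    have h3 := D.tail_add_two_le_head x
    obtain ⟨h4, h5⟩ := hax
    have h6 : a = c → D.tail a = D.tail c ∧ D.head a = D.head c := fun h => by simp [h]
    have h7 : x = c → D.tail x = D.tail c ∧ D.head x = D.head c := fun h => by simp [h]
    omega
  · have h1 := hw.imp keyMark_tailSel keyMark_headSel
    have h2 := hv.imp keyMark_tailSel keyMark_headSel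
    have h3 := D.tail_add_two_le_head x
    have h4 := D.tail_add_two_le_head y
    have h6 : y = c → D.tail y = D.tail c ∧ D.head y = D.head c := fun h => by simp [h]
    have h7 : x = c → D.tail x = D.tail c ∧ D.head x = D.head c := fun h => by simp [h]
    omega

end ChordDiagram

namespace ChordDiagram

variable {n k : ℕ} {D : ChordDiagram n k} {α β γ δ ε : Fin k → ℝ} {c : Fin k}

lemma exists_isParent {a x : Fin k} (h : D.Descendant a x) : ∃ p, D.IsParent p x := by
  obtain ⟨p, hp, hmax⟩ := Finset.exists_max_image (Finset.univ.filter fun m => D.Descendant m x)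
    D.tail ⟨a, by simpa using h⟩
  exact ⟨p, by simpa using hp, fun m hm => hmax m (by simpa using hm)⟩

lemma SignRules.ne_zero (hs : D.SignRules α β γ δ ε) (m : Fin k) : γ m ≠ 0 ∧ δ m ≠ 0 := by
  obtain ⟨-, -, hγ, hδ, -⟩ := hs
  exact ⟨right_ne_zero_of_mul (hγ m).ne', right_ne_zero_of_mul (hδ m).ne'⟩

lemma SignRules.abs_div_abs (hs : D.SignRules α β γ δ ε) (m : Fin k) :
    |δ m| / |γ m| = δ m / γ m := by
  have h := div_pos (hs.2.2.2.1 m) (hs.2.2.1 m)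
  rw [mul_div_mul_left _ _ (by positivity)] at h
  rw [← abs_div, abs_of_pos h]

lemma SignRules.div_lt_div_of_descendant (hs : D.SignRules α β γ δ ε) {a : Fin k} (x : Fin k)
    (h : D.Descendant a x) (hh : D.head x = D.head a) : δ x / γ x < δ a / γ a := by
  obtain ⟨p, hp⟩ := exists_isParent h
  have h1 := hp.2 a h
  have hlt := hp.1.lt
  rcases (D.tail_strictMono.le_iff_le.1 h1).eq_or_lt with rfl | hap
  · exact hs.2.2.2.2.2.2.1 x a hp hh
  · have h2 : D.Descendant a p := D.descendant_iff.2 ⟨hap, by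
      have := D.descendant_iff.1 h
      have := hp.1.1
      omega⟩
    have h3 := h2.2
    have h4 := hp.1.2
    exact (hs.2.2.2.2.2.2.1 x p hp (by omega)).trans
      (hs.div_lt_div_of_descendant p h2 (by omega))
termination_by x

lemma SignRules.head_head_lt (hs : D.SignRules α β γ δ ε) {a x : Fin k} (h : D.Descendant a x)
    (hh : D.head x = D.head a) : |δ x| * |γ a| < |γ x| * |δ a| := by
  have h1 := hs.div_lt_div_of_descendant x h hh
  rw [← hs.abs_div_abs, ← hs.abs_div_abs, div_lt_div_iff₀ (abs_pos.2 (hs.ne_zero x).1)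
    (abs_pos.2 (hs.ne_zero a).1)] at h1
  rwa [mul_comm |γ x|]

lemma SignRules.head_tail_lt (hs : D.SignRules α β γ δ ε) {x y : Fin k}
    (hh : D.head x = D.tail y) : |δ x| * α y < |γ x| * β y := by
  have h1 := hs.2.2.2.2.2.2.2 y x hh
  rw [← hs.abs_div_abs, div_lt_div_iff₀ (abs_pos.2 (hs.ne_zero x).1) (hs.1 y)] at h1
  rwa [mul_comm |γ x|]

lemma keep_head : D.keep c (D.head c) = 0 ∧ D.keep c (D.head c + 1) = 0 := by
  simp [keep]

lemma keep_tail : D.keep c (D.tail c) = 0 ∧ D.keep c (D.tail c + 1) = 0 := by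
  simp [keep]

lemma keep_of_gt {q : ℕ} (h : D.head c + 2 ≤ q) : D.keep c q = 1 := by
  have := D.tail_add_two_le_head c
  exact if_neg (by omega)

lemma key_nonneg (hs : D.SignRules α β γ δ ε) (u : RowKey k) :
    0 ≤ D.keyFst α γ c u ∧ 0 ≤ D.keySnd β δ c u := by
  obtain ⟨hα, hβ, -⟩ := hs
  cases u with
  | tail m => exact ⟨mul_nonneg (hα m).le (keep_nonneg _), mul_nonneg (hβ m).le (keep_nonneg _)⟩
  | head m => exact ⟨mul_nonneg (abs_nonneg _) (keep_nonneg _),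
      mul_nonneg (abs_nonneg _) (keep_nonneg _)⟩
  | lo => exact ⟨zero_le_one, le_rfl⟩
  | hi => exact ⟨le_rfl, zero_le_one⟩

/-- Two labels at the same pair of markers, the first of which belongs to the head of `x`. -/
lemma keyLE_headKeys (hs : D.SignRules α β γ δ ε) {x y : Fin k} {v w : RowKey k}
    (hv : v ∈ D.headKeys c x)
    (hw : (w ∈ D.headKeys c y ∧ D.Descendant y x) ∨ (w ∈ D.tailKeys c y ∧ D.head x ≤ D.tail y)) :
    KeyLE D.keyPos (D.keyFst α γ c) (D.keySnd β δ c) v w := by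
  rcases lt_or_ge (D.keyPos v) (D.keyPos w) with h | h
  · exact .inl h
  have hpv := keyPos_of_mem_headKeys hv
  have hpos : D.keyPos v = D.keyPos w := by
    rcases hw with ⟨hw, hyx⟩ | ⟨hw, hyx⟩
    · have h1 := hyx.2
      have h2 := keyPos_of_mem_headKeys hw
      omega
    · have h2 := keyPos_of_mem_tailKeys hw
      omega
  refine .inr ⟨hpos, ?_⟩
  obtain ⟨hh0, hh1⟩ := keep_head (D := D) (c := c)
  obtain ⟨ht0, ht1⟩ := keep_tail (D := D) (c := c)
  rcases hw with ⟨hw, hyx⟩ | ⟨hw, hyx⟩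
  · rw [hpv, keyPos_of_mem_headKeys hw] at hpos
    rcases mem_headKeys hv with ⟨rfl, hv⟩ | ⟨hx, rfl⟩
    · rcases mem_headKeys hw with ⟨rfl, -⟩ | ⟨-, rfl⟩
      · exact absurd hyx.1 (lt_irrefl _)
      · simp [keyFst, keySnd, ← hpos, hh0, hh1]
    · rcases mem_headKeys hw with ⟨rfl, hw⟩ | ⟨-, rfl⟩
      · simp [keyFst, keySnd, hpos, hh0, hh1]
      · have := mul_le_mul_of_nonneg_right (hs.head_head_lt hyx hpos).le
          (mul_nonneg (keep_nonneg (D := D) (c := c) (D.head y))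
            (keep_nonneg (D := D) (c := c) (D.head y + 1)))
        simp only [keyFst, keySnd, hpos]
        linarith
  · rw [hpv, keyPos_of_mem_tailKeys hw] at hpos
    rcases mem_headKeys hv with ⟨rfl, hv⟩ | ⟨hx, rfl⟩
    · rcases mem_tailKeys hw with ⟨rfl, -⟩ | ⟨-, rfl⟩
      · have := D.tail_add_two_le_head y
        omega
      · simp [keyFst, keySnd, ← hpos, hh0, hh1]
    · rcases mem_tailKeys hw with ⟨rfl, hw⟩ | ⟨-, rfl⟩
      · simp [keyFst, keySnd, hpos, ht0, ht1]
      · have := mul_le_mul_of_nonneg_right (hs.head_tail_lt hpos).le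
          (mul_nonneg (keep_nonneg (D := D) (c := c) (D.tail y))
            (keep_nonneg (D := D) (c := c) (D.tail y + 1)))
        simp only [keyFst, keySnd, hpos]
        linarith

lemma pairwise_keyLE (hs : D.SignRules α β γ δ ε) {t : Forest (Fin k)}
    (ht : t.Compatible D.Descendant fun x y => D.head x ≤ D.tail y) :
    (t.word (D.tailKeys c) (D.headKeys c)).Pairwise
      (KeyLE D.keyPos (D.keyFst α γ c) (D.keySnd β δ c)) := by
  have lo_hi : ∀ q, KeyLE D.keyPos (D.keyFst α γ c) (D.keySnd β δ c) (.lo q) (.hi q) := fun q =>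
    .inr ⟨rfl, by simp [keyFst, keySnd]⟩
  refine Forest.pairwise_word ht (fun a => ?_) (fun a => ?_) (fun a v hv w hw => .inl ?_)
    (fun a x hax v hv w hw => .inl ?_) (fun a x hax v hv w hw => ?_) (fun x y hxy v hv w hw => ?_)
  · unfold tailKeys; split_ifs <;> simp [lo_hi]
  · unfold headKeys; split_ifs <;> simp [lo_hi]
  · have := D.tail_add_two_le_head a
    rw [keyPos_of_mem_tailKeys hv, keyPos_of_mem_headKeys hw]
    omega
  · have h1 := keyPos_of_mem_tailKeys hv
    have h2 := hw.imp keyPos_of_mem_tailKeys keyPos_of_mem_headKeys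
    have h3 := D.tail_add_two_le_head x
    have h4 := hax.1
    omega
  · rcases hv with hv | hv
    · refine .inl ?_
      rw [keyPos_of_mem_tailKeys hv, keyPos_of_mem_headKeys hw]
      have h3 := D.tail_add_two_le_head x
      have h4 := hax.2
      omega
    · exact keyLE_headKeys hs hv (.inl ⟨hw, hax⟩)
  · by_cases h : v ∈ D.headKeys c x ∧ w ∈ D.tailKeys c y
    · exact keyLE_headKeys hs h.1 (.inr ⟨h.2, hxy⟩)
    · have h3 := D.tail_add_two_le_head x
      have h4 := D.tail_add_two_le_head y
      refine .inl ?_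
      rcases hv with hv | hv <;> rcases hw with hw | hw
      · rw [keyPos_of_mem_tailKeys hv, keyPos_of_mem_tailKeys hw]; omega
      · rw [keyPos_of_mem_tailKeys hv, keyPos_of_mem_headKeys hw]; omega
      · exact absurd ⟨hv, hw⟩ h
      · rw [keyPos_of_mem_headKeys hv, keyPos_of_mem_headKeys hw]; omega

lemma keyPos_of_mem_tailSel {m : Fin k} {u : RowKey k} (h : u ∈ D.tailSel c m) :
    D.keyPos u = D.tail m := keyPos_of_mem_tailKeys ((tailSel_sublist m).subset h)

lemma keyPos_of_mem_headSel {m : Fin k} {u : RowKey k} (h : u ∈ D.headSel c m) :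
    D.keyPos u = D.head m := keyPos_of_mem_headKeys ((headSel_sublist m).subset h)

lemma pairwise_sel (hs : D.SignRules α β γ δ ε) {t : Forest (Fin k)}
    (ht : t.Compatible D.Descendant fun x y => D.head x ≤ D.tail y) :
    (t.word (D.tailSel c) (D.headSel c)).Pairwise fun v w => D.keyPos v = D.keyPos w →
      D.keySnd β δ c v * D.keyFst α γ c w < D.keyFst α γ c v * D.keySnd β δ c w := by
  have hc := D.tail_add_two_le_head c
  refine Forest.pairwise_word ht (fun a => ?_) (fun a => ?_) (fun a v hv w hw h => ?_)
    (fun a x hax v hv w hw h => ?_) (fun a x hax v hv w hw h => ?_)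
    (fun x y hxy v hv w hw h => ?_)
  · unfold tailSel; split_ifs <;> simp [keyFst, keySnd]
  · unfold headSel; split_ifs <;> simp [keyFst, keySnd]
  · rw [keyPos_of_mem_tailSel hv, keyPos_of_mem_headSel hw] at h
    have := D.tail_add_two_le_head a
    omega
  · have h1 := keyPos_of_mem_tailSel hv
    have h2 := hw.imp keyPos_of_mem_tailSel keyPos_of_mem_headSel
    have h3 := D.tail_add_two_le_head x
    have h4 := hax.1
    omega
  · rw [keyPos_of_mem_headSel hw] at h
    have h3 := D.tail_add_two_le_head x
    obtain ⟨h4, h5⟩ := hax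
    rcases hv with hv | hv
    · rw [keyPos_of_mem_tailSel hv] at h
      omega
    · rw [keyPos_of_mem_headSel hv] at h
      have h6 := keyMark_headSel hv
      have h7 := keyMark_headSel hw
      have h8 : a = c → D.tail a = D.tail c ∧ D.head a = D.head c := fun h => by simp [h]
      have h9 : x = c → D.tail x = D.tail c ∧ D.head x = D.head c := fun h => by simp [h]
      omega
  · have h3 := D.tail_add_two_le_head x
    have h4 := D.tail_add_two_le_head y
    rcases hv with hv | hv <;> rcases hw with hw | hw
    · rw [keyPos_of_mem_tailSel hv, keyPos_of_mem_tailSel hw] at h; omega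
    · rw [keyPos_of_mem_tailSel hv, keyPos_of_mem_headSel hw] at h; omega
    · rw [keyPos_of_mem_headSel hv, keyPos_of_mem_tailSel hw] at h
      rcases mem_headSel hv with ⟨rfl, -⟩ | ⟨-, h5, rfl⟩ <;>
        rcases mem_tailSel hw with ⟨rfl, -⟩ | ⟨-, h6, rfl⟩
      · omega
      · exact absurd h.symm h6
      · omega
      · have h7 := keep_of_gt (D := D) (c := c) (q := D.tail y) (by omega)
        have h8 := keep_of_gt (D := D) (c := c) (q := D.tail y + 1) (by omega)
        simpa [keyFst, keySnd, h, h7, h8] using hs.head_tail_lt h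
    · rw [keyPos_of_mem_headSel hv, keyPos_of_mem_headSel hw] at h; omega

lemma keyMark_spec (hs : D.SignRules α β γ δ ε) {m : Fin k} {u : RowKey k}
    (h : u ∈ D.tailSel c m ∨ u ∈ D.headSel c m) :
    (D.keyMark c u = D.keyPos u ∧ 0 < D.keyFst α γ c u) ∨
      (D.keyMark c u = D.keyPos u + 1 ∧ 0 < D.keySnd β δ c u) := by
  have hc := D.tail_add_two_le_head c
  have hm := D.tail_add_two_le_head m
  rcases h with h | h
  · rcases mem_tailSel h with ⟨rfl, rfl | rfl⟩ | ⟨h1, h2, rfl⟩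
    · simp [keyMark, keyPos, keyFst]
    · simp [keyMark, keyPos, keySnd]
    · have h3 := tail_ne (D := D) h1
      simp only [keyMark]
      split_ifs with h4
      · left
        have : D.keep c (D.tail m) = 1 := if_neg (by omega)
        simpa [keyPos, keyFst, this] using hs.1 m
      · right
        have : D.keep c (D.tail m + 1) = 1 := if_neg fun h5 => by
          have h6 : D.tail m + 1 = D.head c := by omega
          have := (D.descendant_iff (l := c) (m := m)).2
            ⟨D.tail_strictMono.lt_iff_lt.1 (by omega), by omega⟩
          have := this.2
          omega
        simpa [keyPos, keySnd, this] using hs.2.1 m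
  · rcases mem_headSel h with ⟨rfl, rfl | rfl⟩ | ⟨h1, h2, rfl⟩
    · simp [keyMark, keyPos, keyFst]
    · simp [keyMark, keyPos, keySnd]
    · left
      have := keep_of_gt (D := D) (c := c) (q := D.head m) (by omega)
      simpa [keyMark, keyPos, keyFst, this] using (hs.ne_zero m).1

end ChordDiagram

section Keys

variable {V : Type*} [AddCommGroup V] [Module ℝ V] {σ : Type*} {e : ℕ → V}
  {pos : σ → ℕ} {a b : σ → ℝ} {f : σ → V}

lemma WedgePos.of_keys {x : ExteriorAlgebra ℝ V} {n : ℕ} {l s : List σ}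
    (hf : ∀ t, f t = a t • e (pos t) + b t • e (pos t + 1)) {g : σ → ℕ}
    (hl : l.Pairwise (KeyLE pos a b)) (hab : ∀ t ∈ l, 0 ≤ a t ∧ 0 ≤ b t)
    (hpos : ∀ t ∈ l, 1 ≤ pos t ∧ pos t + 1 ≤ n)
    (hs : s.Pairwise fun t t' => pos t = pos t' → b t * a t' < a t * b t')
    (hg : ∀ t ∈ s, (g t = pos t ∧ 0 < a t) ∨ (g t = pos t + 1 ∧ 0 < b t))
    (hgs : s.Pairwise fun t t' => g t < g t') (hx : WedgePos f l s x) :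
    WedgePos e (List.range' 1 n) (s.map g) x := by
  obtain ⟨hsl, c, hc, y, hy, rfl⟩ := hx
  refine WedgePos.add (.smul ?_ hc) ?_
  · have := WedgePos.mul_wedge hf (g := g) s hs (fun t ht => hab t (hsl.subset ht)) hg
      (fun t ht => ⟨Nat.zero_le _, hpos t (hsl.subset ht)⟩) (Nat.zero_le n)
      (wedgePos_nil (f := e)) (by simpa [List.pairwise_map] using hgs)
    simpa using this
  · rw [List.length_map]
    refine wedgeCone_induction (fun l' hl' hd => ?_) (zero_mem _) (fun x y => add_mem)
      (fun c x hc => smul_mem_wedgeCone hc) hy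
    have := mul_wedge_mem_wedgeCone (x := 1) (q := 0) (d := 0) (e := e) hf l' (hl.sublist hl')
      (fun t ht => hab t (hl'.subset ht)) (fun t ht => ⟨Nat.zero_le _, hpos t (hl'.subset ht)⟩)
      (Nat.zero_le n) (by simpa using wedge_mem_wedgeCone (f := e) (List.nil_sublist _) rfl)
    rw [one_mul, zero_add] at this
    rwa [← hd, add_zero]

lemma mul_ι_mul_ι_comm (v w : V) (x : ExteriorAlgebra ℝ V) :
    x * (ExteriorAlgebra.ι ℝ v * ExteriorAlgebra.ι ℝ w) =
      ExteriorAlgebra.ι ℝ v * ExteriorAlgebra.ι ℝ w * x := by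
  induction x using ExteriorAlgebra.induction with
  | algebraMap r => exact Algebra.commutes r _
  | ι u =>
    have := wedge_mul_ι [v, w] u
    simpa using this.symm
  | mul x y hx hy => rw [mul_assoc, hy, ← mul_assoc, hx, mul_assoc]
  | add x y hx hy => rw [add_mul, mul_add, hx, hy]

end Keys

namespace ChordDiagram

variable {n k : ℕ} {V : Type*} [AddCommGroup V] [Module ℝ V]

section Rows

variable (D : ChordDiagram n k) (α β γ δ ε : Fin k → ℝ) (e : ℕ → V) (c : Fin k)

/-- The vector attached to a key. -/
def keyVec (u : RowKey k) : V :=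
  D.keyFst α γ c u • e (D.keyPos u) + D.keySnd β δ c u • e (D.keyPos u + 1)

/-- The contribution of the tail of the chord `m` to its own row. -/
def tailVec (m : Fin k) : V := α m • e (D.tail m) + β m • e (D.tail m + 1)

/-- The row of `m` in the product of the domino matrix with the matrix of rows `e 1, …, e n`. -/
def rowVec (m : Fin k) : V :=
  D.tailVec α β e m + (γ m • e (D.head m) + δ m • e (D.head m + 1)) +
    ((if D.IsTop m then ε m • e n else 0) +
      ∑ p, if D.IsParent p m then ε m • D.tailVec α β e p else 0)

/-- The exterior product of the vectors at the four markers of the chord `c`. -/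
def markers : ExteriorAlgebra ℝ V :=
  ExteriorAlgebra.ι ℝ (e (D.tail c)) * ExteriorAlgebra.ι ℝ (e (D.tail c + 1)) *
    (ExteriorAlgebra.ι ℝ (e (D.head c)) * ExteriorAlgebra.ι ℝ (e (D.head c + 1)))

end Rows

variable {D : ChordDiagram n k} {α β γ δ ε : Fin k → ℝ} {e : ℕ → V} {c : Fin k}

lemma IsParent.eq {a a' m : Fin k} (h : D.IsParent a m) (h' : D.IsParent a' m) : a = a' :=
  D.tail_strictMono.injective ((h'.2 a h.1).antisymm (h.2 a' h'.1))

lemma mul_markers_comm (x : ExteriorAlgebra ℝ V) :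
    x * D.markers e c = D.markers e c * x := by
  unfold markers
  rw [← mul_assoc, mul_ι_mul_ι_comm (e (D.tail c)), mul_assoc, mul_ι_mul_ι_comm (e (D.head c)),
    ← mul_assoc]

lemma ι_mul_markers (q : ℕ) : ExteriorAlgebra.ι ℝ (e q) * D.markers e c =
    D.keep c q • (ExteriorAlgebra.ι ℝ (e q) * D.markers e c) := by
  unfold keep
  split_ifs with h
  · have h1 : ∀ v w : V,
        ExteriorAlgebra.ι ℝ v * (ExteriorAlgebra.ι ℝ v * ExteriorAlgebra.ι ℝ w) = 0 :=
      fun v w => by rw [← mul_assoc, ExteriorAlgebra.ι_sq_zero, zero_mul]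
    have h2 : ∀ v w : V,
        ExteriorAlgebra.ι ℝ w * (ExteriorAlgebra.ι ℝ v * ExteriorAlgebra.ι ℝ w) = 0 :=
      fun v w => by rw [mul_ι_mul_ι_comm, mul_assoc, ExteriorAlgebra.ι_sq_zero, mul_zero]
    rw [zero_smul, markers]
    rcases h with rfl | rfl | rfl | rfl
    · rw [← mul_assoc, h1, zero_mul]
    · rw [← mul_assoc, h2, zero_mul]
    · rw [← mul_ι_mul_ι_comm, ← mul_assoc, h1, zero_mul]
    · rw [← mul_ι_mul_ι_comm, ← mul_assoc, h2, zero_mul]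
  · rw [one_smul]

lemma ι_keyVec_tail_mul_markers (m : Fin k) :
    ExteriorAlgebra.ι ℝ (D.keyVec α β γ δ e c (.tail m)) * D.markers e c =
      ExteriorAlgebra.ι ℝ (D.tailVec α β e m) * D.markers e c := by
  simp only [keyVec, tailVec, keyFst, keySnd, keyPos, map_add, map_smul, add_mul, smul_mul_assoc,
    mul_smul, ← ι_mul_markers]

lemma ι_keyVec_head_mul_markers (m : Fin k) :
    ExteriorAlgebra.ι ℝ (D.keyVec α β γ δ e c (.head m)) * D.markers e c =
      ExteriorAlgebra.ι ℝ (|γ m| • e (D.head m) + |δ m| • e (D.head m + 1)) * D.markers e c := by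
  simp only [keyVec, keyFst, keySnd, keyPos, map_add, map_smul, add_mul, smul_mul_assoc,
    mul_smul, ← ι_mul_markers]

lemma eq_neg_one_pow_mul_abs {b : ℕ} {x : ℝ} (h : 0 < (-1 : ℝ) ^ b * x) :
    x = (-1 : ℝ) ^ b * |x| := by
  rcases neg_one_pow_eq_or ℝ b with hb | hb <;> rw [hb] at h ⊢
  · rw [one_mul] at h ⊢
    rw [abs_of_pos h]
  · rw [abs_of_neg (by linarith)]
    ring

lemma SignRules.abs_pos (hs : D.SignRules α β γ δ ε) (m : Fin k) : 0 < |ε m| := by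
  obtain ⟨-, -, -, -, h1, h2, -⟩ := hs
  by_cases h : D.IsTop m
  · exact _root_.abs_pos.2 (right_ne_zero_of_mul (h1 m h).ne')
  · unfold IsTop at h
    push Not at h
    obtain ⟨a, ha⟩ := h
    obtain ⟨p, hp⟩ := exists_isParent ha
    exact _root_.abs_pos.2 (right_ne_zero_of_mul (h2 m p hp).ne')

lemma ι_rowVec_mul_markers (hs : D.SignRules α β γ δ ε) {m : Fin k} {b g : ℕ}
    {par : Option (Fin k)} (hg : D.below m = g) (hnone : par = none → D.IsTop m ∧ b = m)
    (hsome : ∀ a, par = some a → D.IsParent a m ∧ D.beyond m a = b) :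
    ExteriorAlgebra.ι ℝ (D.rowVec α β γ δ ε e m) * D.markers e c =
      ExteriorAlgebra.ι ℝ (D.keyVec α β γ δ e c (.tail m) +
        (-1 : ℝ) ^ g • D.keyVec α β γ δ e c (.head m) + ((-1 : ℝ) ^ b * |ε m|) •
        par.elim ((-1 : ℝ) ^ (k - 1) • e n) fun a => D.keyVec α β γ δ e c (.tail a)) *
        D.markers e c := by
  obtain ⟨-, -, hγ, hδ, htop, hpar, -⟩ := hs
  have h1 : γ m • e (D.head m) + δ m • e (D.head m + 1) =
      (-1 : ℝ) ^ g • (|γ m| • e (D.head m) + |δ m| • e (D.head m + 1)) := by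
    conv_lhs => rw [eq_neg_one_pow_mul_abs (hγ m), eq_neg_one_pow_mul_abs (hδ m), hg]
    rw [smul_add, smul_smul, smul_smul]
  rw [rowVec, h1]
  have add : ∀ {u u' v v' : V},
      ExteriorAlgebra.ι ℝ u * D.markers e c = ExteriorAlgebra.ι ℝ u' * D.markers e c →
      ExteriorAlgebra.ι ℝ v * D.markers e c = ExteriorAlgebra.ι ℝ v' * D.markers e c →
      ExteriorAlgebra.ι ℝ (u + v) * D.markers e c = ExteriorAlgebra.ι ℝ (u' + v') * D.markers e c :=
    fun h h' => by rw [map_add, map_add, add_mul, add_mul, h, h']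
  have smul : ∀ (r : ℝ) {u u' : V},
      ExteriorAlgebra.ι ℝ u * D.markers e c = ExteriorAlgebra.ι ℝ u' * D.markers e c →
      ExteriorAlgebra.ι ℝ (r • u) * D.markers e c = ExteriorAlgebra.ι ℝ (r • u') * D.markers e c :=
    fun r _ _ h => by rw [map_smul, map_smul, smul_mul_assoc, smul_mul_assoc, h]
  refine add (add (ι_keyVec_tail_mul_markers m).symm
    (smul _ (ι_keyVec_head_mul_markers m).symm)) ?_
  cases par with
  | none =>
    obtain ⟨h2, rfl⟩ := hnone rfl
    have h3 : ∀ p, ¬ D.IsParent p m := fun p hp => h2 p hp.1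
    have h4 := htop m h2
    rw [behind_eq] at h4
    have h5 : ε m • e n = ((-1 : ℝ) ^ (m : ℕ) * |ε m|) • ((-1 : ℝ) ^ (k - 1) • e n) := by
      conv_lhs => rw [eq_neg_one_pow_mul_abs h4]
      have h6 := Forest.neg_one_pow_cancel (k - 1 - m) m
      rw [Nat.sub_add_cancel (by omega)] at h6
      rw [smul_smul, ← h6]
      ring_nf
    rw [if_pos h2, Finset.sum_eq_zero fun p _ => if_neg (h3 p), add_zero, h5,
      Option.elim]
  | some a =>
    obtain ⟨h2, rfl⟩ := hsome a rfl
    have h3 : ∀ p ∈ Finset.univ, p ≠ a →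
        (if D.IsParent p m then ε m • D.tailVec α β e p else 0) = 0 :=
      fun p _ hp => if_neg fun h => hp (h.eq h2)
    rw [if_neg fun h => h a h2.1, zero_add, Finset.sum_eq_single a h3 (by simp), if_pos h2,
      ← eq_neg_one_pow_mul_abs (hpar m a h2)]
    exact smul _ (ι_keyVec_tail_mul_markers a).symm

lemma prod_rowVec_mul_markers (hs : D.SignRules α β γ δ ε) {t : Forest (Fin k)} {b : ℕ}
    {par : Option (Fin k)} (ht : D.Fits b par t) :
    (t.nodes.map fun m => ExteriorAlgebra.ι ℝ (D.rowVec α β γ δ ε e m)).prod * D.markers e c =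
      t.expand (fun m => D.keyVec α β γ δ e c (.tail m)) (fun m => D.keyVec α β γ δ e c (.head m))
        (fun m => |ε m|) b
        (par.elim ((-1 : ℝ) ^ (k - 1) • e n) fun a => D.keyVec α β γ δ e c (.tail a)) *
        D.markers e c := by
  induction t generalizing b par with
  | nil => rfl
  | node m G R hG hR =>
    obtain ⟨h1, h2, h3, h4, h5⟩ := ht
    rw [Forest.nodes, List.map_cons, List.map_append, List.prod_cons, List.prod_append,
      Forest.expand,
      mul_assoc, mul_assoc (List.prod _), hR h5, mul_markers_comm, ← mul_assoc (List.prod _), hG h4,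
      mul_assoc (Forest.expand _ _ _ _ _ _), ← mul_markers_comm,
      ← mul_assoc (Forest.expand _ _ _ _ _ _),
      mul_markers_comm, ← mul_assoc,
      ι_rowVec_mul_markers hs h1 h2 h3, mul_assoc, ← mul_markers_comm, ← mul_assoc]
    rfl

lemma selects (hs : D.SignRules α β γ δ ε) {m : Fin k} (hm : m ≠ c) :
    Forest.Selects (D.keyVec α β γ δ e c) (D.tailKeys c) (D.headKeys c) (D.tailSel c)
      (D.headSel c) (fun m => D.keyVec α β γ δ e c (.tail m))
      (fun m => D.keyVec α β γ δ e c (.head m)) (fun m => |ε m|) m := by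
  have hι : ∀ u, wedge ([u].map (D.keyVec α β γ δ e c)) =
      ExteriorAlgebra.ι ℝ (D.keyVec α β γ δ e c u) := fun u => by simp
  refine ⟨?_, ?_, hs.abs_pos m, ?_⟩
  · rw [tailKeys, if_neg hm, ← hι]
    exact wedge_mem_wedgeCone (List.Sublist.refl _) rfl
  · rw [headKeys, if_neg hm, ← hι]
    exact wedge_mem_wedgeCone (List.Sublist.refl _) rfl
  · simp only [tailKeys, headKeys, tailSel, headSel, if_neg hm, ← hι]
    split_ifs
    · exact .inr ⟨rfl, wedgePos_self, rfl⟩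
    · exact .inl ⟨wedgePos_self, rfl, rfl⟩

lemma exists_wedgePos (hs : D.SignRules α β γ δ ε) (e : ℕ → V) (c : Fin k) :
    ∃ s : List ℕ, s.length = k + 4 ∧ WedgePos e (List.range' 1 n) s
      (((List.finRange k).map fun m => ExteriorAlgebra.ι ℝ (D.rowVec α β γ δ ε e m)).prod *
        D.markers e c) := by
  obtain ⟨t, ht, hfit, hnodes⟩ := D.exists_forest
  have hc := D.tail_add_two_le_head c
  have hcn := D.head_add_two_le c
  have hsize : t.size = k := by rw [← t.length_nodes, hnodes, List.length_finRange]
  obtain ⟨hh0, hh1⟩ := keep_head (D := D) (c := c)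
  obtain ⟨ht0, ht1⟩ := keep_tail (D := D) (c := c)
  have hlohi : ∀ q, wedge ([RowKey.lo q, .hi q].map (D.keyVec α β γ δ e c)) =
      ExteriorAlgebra.ι ℝ (e q) * ExteriorAlgebra.ι ℝ (e (q + 1)) := fun q => by
    simp [keyVec, keyFst, keySnd, keyPos]
  obtain ⟨x, y, hx, hy, hlen, hxy⟩ := Forest.exists_expand_mul_eq
    (f := D.keyVec α β γ δ e c) (tl := D.tailKeys c) (hd := D.headKeys c) (tl' := D.tailSel c)
    (hd' := D.headSel c) (T := fun m => D.keyVec α β γ δ e c (.tail m))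
    (H := fun m => D.keyVec α β γ δ e c (.head m)) (ε := fun m => |ε m|) (c := c)
    (E := ExteriorAlgebra.ι ℝ (e (D.tail c)) * ExteriorAlgebra.ι ℝ (e (D.tail c + 1)))
    (E' := ExteriorAlgebra.ι ℝ (e (D.head c)) * ExteriorAlgebra.ι ℝ (e (D.head c + 1)))
    ht (fun a ha => by
      have h1 := (D.descendant_iff.1 ha).2
      have h2 := ha.1
      rw [headSel, if_neg ha.lt.ne, if_neg (by omega)])
    (fun a _ hac => selects hs hac) (by rw [hnodes]; exact List.nodup_finRange k)
    (by rw [hnodes]; exact List.mem_finRange c)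
    (by simp [keyVec, keyFst, keySnd, ht0, ht1]) (by simp [keyVec, keyFst, keySnd, hh0, hh1])
    (hs.abs_pos c) (by rw [tailKeys, tailSel, if_pos rfl, if_pos rfl, ← hlohi]; exact wedgePos_self)
    (by rw [tailSel, if_pos rfl]; rfl) (mul_ι_mul_ι_comm _ _)
    (by rw [headKeys, headSel, if_pos rfl, if_pos rfl, ← hlohi]; exact wedgePos_self)
    (by rw [headSel, if_pos rfl]; rfl) (mul_ι_mul_ι_comm _ _)
  rw [hsize] at hx hlen
  have hk : 0 < k := c.pos
  have hn : n - 1 + 1 = n := by omega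
  have hlast : wedge ([RowKey.hi (n - 1)].map (D.keyVec α β γ δ e c)) =
      ExteriorAlgebra.ι ℝ (e n) := by
    simp [keyVec, keyFst, keySnd, keyPos, hn]
  have htotal : ((List.finRange k).map fun m =>
      ExteriorAlgebra.ι ℝ (D.rowVec α β γ δ ε e m)).prod * D.markers e c =
      y * wedge ([RowKey.hi (n - 1)].map (D.keyVec α β γ δ e c)) + x := by
    rw [← hnodes, prod_rowVec_mul_markers hs hfit, markers, hxy, hlast,
      wedgeCone_mul_ι (hy.mem (j := 0) (d := k + 3) (by omega)), add_comm x]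
    have h1 : (-1 : ℝ) ^ (k + 3) = (-1 : ℝ) ^ (k - 1) := by
      rw [show k + 3 = k - 1 + 4 by omega, pow_add]; norm_num
    simp [h1]
  have hpos : ∀ u ∈ t.word (D.tailKeys c) (D.headKeys c), 1 ≤ D.keyPos u ∧ D.keyPos u + 2 ≤ n := by
    intro u hu
    obtain ⟨m, -, hm⟩ := Forest.mem_word.1 hu
    have h1 := hm.imp keyPos_of_mem_tailKeys keyPos_of_mem_headKeys
    have h2 := D.tail_add_two_le_head m
    have h3 := D.head_add_two_le m
    have h4 := D.one_le_tail m
    omega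
  have hmark : ∀ u ∈ t.word (D.tailSel c) (D.headSel c),
      (D.keyMark c u = D.keyPos u ∧ 0 < D.keyFst α γ c u) ∨
      (D.keyMark c u = D.keyPos u + 1 ∧ 0 < D.keySnd β δ c u) := by
    intro u hu
    obtain ⟨m, -, hm⟩ := Forest.mem_word.1 hu
    exact keyMark_spec hs hm
  have hposS := fun u hu => hpos u (hy.1.subset hu)
  refine ⟨(t.word (D.tailSel c) (D.headSel c) ++ [RowKey.hi (n - 1)]).map (D.keyMark c),
    by simp; omega, ?_⟩
  rw [htotal]
  refine WedgePos.of_keys (f := D.keyVec α β γ δ e c) (fun u => rfl) ?_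
    (fun u _ => key_nonneg hs u) (fun u hu => ?_) ?_ (fun u hu => ?_) ?_
    ((hy.mul wedgePos_self).add ?_)
  · refine List.pairwise_append.2 ⟨pairwise_keyLE hs ht, List.pairwise_singleton _ _,
      fun u hu v hv => .inl ?_⟩
    rw [List.mem_singleton.1 hv]
    have := hpos u hu
    have hpos_hi : D.keyPos (.hi (n - 1)) = n - 1 := rfl
    omega
  · rcases List.mem_append.1 hu with hu | hu
    · have := hpos u hu
      omega
    · rw [List.mem_singleton.1 hu]
      simp only [keyPos]
      omega
  · refine List.pairwise_append.2 ⟨pairwise_sel hs ht, List.pairwise_singleton _ _,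
      fun u hu v hv huv => ?_⟩
    rw [List.mem_singleton.1 hv] at huv
    have := hposS u hu
    have hpos_hi : D.keyPos (.hi (n - 1)) = n - 1 := rfl
    omega
  · rcases List.mem_append.1 hu with hu | hu
    · exact hmark u hu
    · rw [List.mem_singleton.1 hu]
      exact .inr ⟨rfl, one_pos⟩
  · refine List.pairwise_append.2 ⟨pairwise_keyMark ht, List.pairwise_singleton _ _,
      fun u hu v hv => ?_⟩
    rw [List.mem_singleton.1 hv]
    have := hposS u hu
    have := hmark u hu
    have hmark_hi : D.keyMark c (.hi (n - 1)) = n - 1 + 1 := rfl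
    omega
  · refine wedgeCone_mono (List.sublist_append_left _ _) ?_ hx
    rw [List.length_append, List.length_singleton]
    omega

end ChordDiagram

section Determinant

variable {n r : ℕ}

/-- The linear form on the exterior algebra which sends a product of `r` rows to the determinant. -/
def detForm (r : ℕ) : ExteriorAlgebra ℝ (Fin r → ℝ) →ₗ[ℝ] ℝ :=
  ExteriorAlgebra.liftAlternating (Pi.single r Matrix.detRowAlternating)

lemma detForm_wedge_ofFn (v : Fin r → Fin r → ℝ) :
    detForm r (wedge (List.ofFn v)) = (Matrix.of v).det := by
  have h : wedge (List.ofFn v) = ExteriorAlgebra.ιMulti ℝ r v := by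
    rw [ExteriorAlgebra.ιMulti_apply, wedge, List.map_ofFn]
    rfl
  rw [h, detForm, ExteriorAlgebra.liftAlternating_apply_ιMulti, Pi.single_eq_same]
  rfl

lemma IsPositiveMatrix.detForm_wedge_pos {Z : Matrix (Fin n) (Fin r) ℝ} (hZ : IsPositiveMatrix Z)
    {s : List ℕ} (hs : s.Sublist (List.range' 1 n)) (hr : s.length = r) :
    0 < detForm r (wedge (s.map (markerRow Z))) := by
  subst hr
  have hmem : ∀ i : Fin s.length, 1 ≤ s.get i ∧ s.get i - 1 < n := fun i => by
    have := List.mem_range'_1.1 (hs.subset (s.get_mem i))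
    omega
  have hlt : s.Pairwise (· < ·) := (List.pairwise_lt_range' (s := 1)).sublist hs
  have h1 : s.map (markerRow Z) = List.ofFn fun i => Z ⟨s.get i - 1, (hmem i).2⟩ := by
    refine List.ext_get (by simp) fun i h₁ h₂ => ?_
    have := (hmem ⟨i, by simpa using h₁⟩).2
    simp only [List.get_eq_getElem] at this
    simp [markerRow, this]
  rw [h1, detForm_wedge_ofFn]
  refine hZ (fun i => ⟨s.get i - 1, (hmem i).2⟩) fun i j hij => ?_
  have h2 := List.pairwise_iff_get.1 hlt i j hij
  have h3 := hmem i
  rw [Fin.mk_lt_mk]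
  omega

lemma IsPositiveMatrix.detForm_pos {Z : Matrix (Fin n) (Fin r) ℝ} (hZ : IsPositiveMatrix Z)
    {s : List ℕ} {x : ExteriorAlgebra ℝ (Fin r → ℝ)} (hr : s.length = r)
    (hx : WedgePos (markerRow Z) (List.range' 1 n) s x) : 0 < detForm r x := by
  obtain ⟨hs, c, hc, y, hy, rfl⟩ := hx
  rw [map_add, map_smul]
  refine add_pos_of_pos_of_nonneg (smul_pos hc (hZ.detForm_wedge_pos hs hr)) ?_
  refine wedgeCone_induction (p := fun z => 0 ≤ detForm r z)
    (fun s' hs' hd => (hZ.detForm_wedge_pos hs' (by omega)).le)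
    (map_zero _).ge (fun x y hx hy => ?_) (fun c x hc hx => ?_) hy
  · rw [map_add]; exact add_nonneg hx hy
  · rw [map_smul]; exact smul_nonneg hc hx

lemma twistor_eq_detForm {k : ℕ} (Z : Matrix (Fin n) (Fin (k + 4)) ℝ)
    (Y : Matrix (Fin k) (Fin (k + 4)) ℝ) (a : Fin 4 → ℕ) :
    twistor Z Y a = detForm (k + 4) (wedge (List.ofFn fun i => Y i) *
      wedge (List.ofFn fun t => markerRow Z (a t))) := by
  rw [← wedge_append, ← List.ofFn_fin_append, detForm_wedge_ofFn, twistor]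
  congr 1
  ext i j
  refine Fin.addCases (fun i => ?_) (fun i => ?_) i <;> simp

lemma sum_ite_mul_eq {Z : Matrix (Fin n) (Fin r) ℝ} {q : ℕ} (hq : 1 ≤ q) (hqn : q ≤ n) (x : ℝ)
    (j : Fin r) : ∑ a : Fin n, (if (a : ℕ) + 1 = q then x else 0) * Z a j =
      x * markerRow Z q j := by
  have h : q - 1 < n := by omega
  rw [Finset.sum_eq_single ⟨q - 1, h⟩ (fun a _ ha => ?_) (by simp)]
  · rw [if_pos (by simp; omega), markerRow, dif_pos h]
  · rw [if_neg fun h' => ha (Fin.ext (by simp; omega)), zero_mul]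

end Determinant

namespace ChordDiagram

variable {n k : ℕ} {D : ChordDiagram n k} {α β γ δ ε : Fin k → ℝ}

lemma dominoMatrix_mul (Z : Matrix (Fin n) (Fin r) ℝ) (m : Fin k) :
    (D.dominoMatrix α β γ δ ε * Z) m = D.rowVec α β γ δ ε (markerRow Z) m := by
  have hb : ∀ p, 1 ≤ D.tail p ∧ D.tail p + 2 ≤ D.head p ∧ D.head p + 2 ≤ n := fun p =>
    ⟨D.one_le_tail p, D.tail_add_two_le_head p, D.head_add_two_le p⟩
  have hm := hb m
  ext j
  rw [Matrix.mul_apply]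
  simp only [dominoMatrix, Matrix.of_apply, add_mul, Finset.sum_add_distrib]
  have htail : ∀ (x : ℝ) p, ∑ a : Fin n, (if (a : ℕ) + 1 = D.tail p then x else 0) * Z a j =
      x * markerRow Z (D.tail p) j := fun x p =>
    sum_ite_mul_eq (by have := hb p; omega) (by have := hb p; omega) x j
  have htail' : ∀ (x : ℝ) p, ∑ a : Fin n, (if (a : ℕ) + 1 = D.tail p + 1 then x else 0) * Z a j =
      x * markerRow Z (D.tail p + 1) j := fun x p =>
    sum_ite_mul_eq (by have := hb p; omega) (by have := hb p; omega) x j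
  have htop : ∑ a : Fin n, (if D.IsTop m ∧ (a : ℕ) + 1 = n then ε m else 0) * Z a j =
      (if D.IsTop m then ε m • markerRow Z n else 0) j := by
    by_cases h : D.IsTop m
    · simp only [h, true_and, if_true]
      exact sum_ite_mul_eq (by omega) le_rfl _ _
    · simp [h]
  have hpar : ∑ a : Fin n, (∑ p, if D.IsParent p m then
        (if (a : ℕ) + 1 = D.tail p then ε m * α p else 0) +
        (if (a : ℕ) + 1 = D.tail p + 1 then ε m * β p else 0) else 0) * Z a j =
      (∑ p, if D.IsParent p m then ε m • D.tailVec α β (markerRow Z) p else 0) j := by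
    simp only [Finset.sum_mul, Finset.sum_apply]
    rw [Finset.sum_comm]
    refine Finset.sum_congr rfl fun p _ => ?_
    by_cases h : D.IsParent p m
    · simp only [h, if_true, add_mul, Finset.sum_add_distrib, htail, htail', tailVec]
      simp only [Pi.smul_apply, Pi.add_apply, smul_eq_mul]
      ring
    · simp [h]
  rw [htail, htail', htop, hpar, sum_ite_mul_eq (by omega) (by omega),
    sum_ite_mul_eq (by omega) (by omega)]
  simp only [rowVec, tailVec, Pi.smul_apply, Pi.add_apply, smul_eq_mul]
  ring

lemma twistor_pos (hs : D.SignRules α β γ δ ε) {Z : Matrix (Fin n) (Fin (k + 4)) ℝ}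
    (hZ : IsPositiveMatrix Z) (c : Fin k) :
    0 < twistor Z (D.dominoMatrix α β γ δ ε * Z)
      ![D.tail c, D.tail c + 1, D.head c, D.head c + 1] := by
  obtain ⟨s, hsk, hpos⟩ := exists_wedgePos hs (markerRow Z) c
  have h := hZ.detForm_pos hsk hpos
  rw [twistor_eq_detForm]
  convert h using 3
  · rw [wedge, List.ofFn_eq_map, List.map_map]
    congr 1
    refine List.map_congr_left fun m _ => ?_
    rw [Function.comp_apply, dominoMatrix_mul]
  · simp [List.ofFn_succ, markers, mul_assoc]

end ChordDiagram

open Matrix in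
lemma twistor_eq_zero_iff {n k : ℕ} {Z : Matrix (Fin n) (Fin (k + 4)) ℝ}
    {Y : Matrix (Fin k) (Fin (k + 4)) ℝ} {a : Fin 4 → ℕ} : twistor Z Y a = 0 ↔
      ∃ v ≠ 0, (∀ m, Y m ⬝ᵥ v = 0) ∧ ∀ t, markerRow Z (a t) ⬝ᵥ v = 0 := by
  rw [twistor, ← Matrix.exists_mulVec_eq_zero_iff]
  refine exists_congr fun v => and_congr_right fun _ => ?_
  rw [funext_iff, ← finSumFinEquiv.forall_congr_right, Sum.forall]
  simp [Matrix.mulVec, dotProduct]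

namespace ChordDiagram

variable {n k : ℕ} {D : ChordDiagram n k} {α β γ δ ε : Fin k → ℝ}

lemma rowVec_of_isTop {V : Type*} [AddCommGroup V] [Module ℝ V] (e : ℕ → V) {c : Fin k}
    (hc : D.IsTop c) : D.rowVec α β γ δ ε e c =
      ∑ i, ![α c, β c, γ c, δ c, ε c] i •
        e (![D.tail c, D.tail c + 1, D.head c, D.head c + 1, n] i) := by
  rw [rowVec, if_pos hc, Finset.sum_eq_zero fun p _ => if_neg fun hp => hc p hp.1, tailVec]
  simp [Fin.sum_univ_five, add_assoc]

lemma twistor_ne_zero_of_isTop (hs : D.SignRules α β γ δ ε) {Z : Matrix (Fin n) (Fin (k + 4)) ℝ}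
    (hZ : IsPositiveMatrix Z) {c : Fin k} (hc : D.IsTop c) (p : Fin 5) :
    twistor Z (D.dominoMatrix α β γ δ ε * Z)
      (fun t => ![D.tail c, D.tail c + 1, D.head c, D.head c + 1, n] (p.succAbove t)) ≠ 0 := by
  intro h
  obtain ⟨v, hv, hY, ha⟩ := twistor_eq_zero_iff.1 h
  have hrow := hY c
  rw [dominoMatrix_mul, rowVec_of_isTop _ hc, sum_dotProduct, Fin.sum_univ_succAbove _ p,
    Finset.sum_eq_zero fun t _ => by rw [smul_dotProduct, ha, smul_zero], add_zero,
    smul_dotProduct, smul_eq_mul] at hrow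
  have hne : ∀ i, ![α c, β c, γ c, δ c, ε c] i ≠ 0 := by
    have h1 := hs.ne_zero c
    have h2 := hs.abs_pos c
    intro i
    fin_cases i
    · exact (hs.1 c).ne'
    · exact (hs.2.1 c).ne'
    · exact h1.1
    · exact h1.2
    · exact _root_.abs_pos.1 h2
  have hp := (mul_eq_zero.1 hrow).resolve_left (hne p)
  have hall : ∀ i, dotProduct (markerRow Z
      (![D.tail c, D.tail c + 1, D.head c, D.head c + 1, n] i)) v = 0 :=
    (Fin.forall_iff_succAbove p).2 ⟨hp, ha⟩
  refine (twistor_pos hs hZ c).ne' (twistor_eq_zero_iff.2 ⟨v, hv, hY, fun t => ?_⟩)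
  have := hall t.castSucc
  fin_cases t <;> exact this

end ChordDiagram

/-- Let `C` be a domino matrix of a chord diagram `D` satisfying the
sign rules, `Z` positive, and `Y = C * Z`.  If `c_l = (i, i+1, j, j+1)` is a top chord,
then all five twistors on 4-element subsets of `{i, i+1, j, j+1, n}` (markers in
increasing order) are nonzero; if `c_l` is not a top chord, then `⟨Y i (i+1) j (j+1)⟩ ≠ 0`. -/
theorem twistors_nonzero_on_bcfw_cell
    (n k : ℕ) (hk : 1 ≤ k) (hn : k + 4 ≤ n)
    (D : ChordDiagram n k) (α β γ δ ε : Fin k → ℝ) (hs : D.SignRules α β γ δ ε)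
    (Z : Matrix (Fin n) (Fin (k + 4)) ℝ) (hZ : IsPositiveMatrix Z)
    (Y : Matrix (Fin k) (Fin (k + 4)) ℝ) (hY : Y = D.dominoMatrix α β γ δ ε * Z) :
    (∀ l : Fin k, D.IsTop l → ∀ p : Fin 5,
        twistor Z Y
          (fun t => ![D.tail l, D.tail l + 1, D.head l, D.head l + 1, n]
            (p.succAbove t)) ≠ 0) ∧
    (∀ l : Fin k, ¬ D.IsTop l →
        twistor Z Y ![D.tail l, D.tail l + 1, D.head l, D.head l + 1] ≠ 0) := by
  subst hY
  exact ⟨fun l hl p => ChordDiagram.twistor_ne_zero_of_isTop hs hZ hl p,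
    fun l _ => (ChordDiagram.twistor_pos hs hZ l).ne'⟩

end
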